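/- arXiv:2603.19491 — 5 statements merged into one kernel-verified Lean document; each statement's English description precedes it below -/
import Mathlib

section
/- For all integers j ≥ 0, all t with 0 ≤ t ≤ 8, and all n ≥ 0, the number a_{27j+3t+2}(27n + 18 + t) is divisible by 3. -/
/-- `a k n` is the number of partitions of `n` in which each odd part may appear in any
of `k` colors and even parts appear in at most one color: equivalently, the number of
`k`-tuples `(λ_0, …, λ_{k-1})` of partitions where `λ_0` is an ordinary partition,
`λ_1, …, λ_{k-1}` are partitions into odd parts, and the sums of their parts add up to `n`.
Each partition is recorded as a multiset of positive parts. -/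
noncomputable def coloredPartition (k n : ℕ) : ℕ :=
  Set.ncard {c : Fin k → Multiset ℕ |
    (∀ i, ∀ x ∈ c i, 0 < x) ∧
    (∀ i : Fin k, i.val ≠ 0 → ∀ x ∈ c i, Odd x) ∧
    (∑ i, (c i).sum) = n}


namespace CP
open Finset

section fin
variable {R : Type*} [CommRing R] (q : R)

theorem phi_partial (n m : ℕ) (hm : m ≤ n) :
    ∑ s ∈ range (m+1), (-1)^s * (∏ k ∈ range s, (1 + q^k)) * (∏ k ∈ Ico s (n+1), (1 - q^(k+1))) * q^(s*(n+2))
     = (1 + q^(n+1)) * ∑ s ∈ range (m+1), (-1)^s * (∏ k ∈ range s, (1 + q^k)) * (∏ k ∈ Ico s n, (1 - q^(k+1))) * q^(s*(n+1))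
      + (-1)^(m+1) * (∏ k ∈ range (m+1), (1 + q^k)) * (∏ k ∈ Ico m n, (1 - q^(k+1))) * q^((m+1)*(n+1)) := by
  induction m with
  | zero =>
    rw [zero_add, sum_range_one, sum_range_one, Finset.prod_Ico_succ_top (Nat.zero_le n)]
    simp
    ring
  | succ m ih =>
    rw [sum_range_succ, ih (by omega), sum_range_succ _ (m+1), prod_range_succ _ (m+1),
      Finset.prod_Ico_succ_top hm, Finset.prod_eq_prod_Ico_succ_bot (show m < n by omega)]
    ring

theorem phi_fin (n : ℕ) :
    (∏ k ∈ range n, (1 + q^(k+1))) * (1 + ∑ k ∈ range n, 2 * (-1)^(k+1) * q^((k+1)^2))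
    = ∑ s ∈ range (n+1), (-1)^s * (∏ k ∈ range s, (1 + q^k)) * (∏ k ∈ Ico s n, (1 - q^(k+1))) * q^(s*(n+1)) := by
  induction n with
  | zero => simp
  | succ n ih =>
    rw [sum_range_succ _ (n+1), phi_partial q n n le_rfl, ← ih, prod_range_succ, sum_range_succ,
      Finset.prod_range_succ' _ n]
    simp
    ring

theorem phi_fin' (n : ℕ) : ∃ g : R,
    (∏ k ∈ range n, (1 + q^(k+1))) * (1 + ∑ k ∈ range n, 2 * (-1)^(k+1) * q^((k+1)^2))
    = (∏ k ∈ range n, (1 - q^(k+1))) + q^(n+1) * g := by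
  refine ⟨∑ s ∈ range n, (-1)^(s+1) * (∏ k ∈ range (s+1), (1 + q^k)) * (∏ k ∈ Ico (s+1) n, (1 - q^(k+1))) * q^(s*(n+1)), ?_⟩
  rw [phi_fin, sum_range_succ', add_comm, mul_sum]
  congr 1
  · simp
  · apply sum_congr rfl; intros; ring

theorem psi_partial (n m : ℕ) (hm : m ≤ n) :
    ∑ s ∈ range (m+1), (∏ k ∈ range s, (1 - q^(2*k+1))) * (∏ k ∈ Ico s (n+1), (1 - q^(2*(k+1)))) * q^(s*(2*n+3))
     = (1 - q^(2*n+1)) * ∑ s ∈ range (m+1), (∏ k ∈ range s, (1 - q^(2*k+1))) * (∏ k ∈ Ico s n, (1 - q^(2*(k+1)))) * q^(s*(2*n+1))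
      + (∏ k ∈ range (m+1), (1 - q^(2*k+1))) * (∏ k ∈ Ico m n, (1 - q^(2*(k+1)))) * q^((m+1)*(2*n+1)) := by
  induction m with
  | zero =>
    rw [zero_add, sum_range_one, sum_range_one, Finset.prod_Ico_succ_top (Nat.zero_le n)]
    simp
    ring
  | succ m ih =>
    rw [sum_range_succ, ih (by omega), sum_range_succ _ (m+1), prod_range_succ _ (m+1),
      Finset.prod_Ico_succ_top hm, Finset.prod_eq_prod_Ico_succ_bot (show m < n by omega)]
    ring

theorem psi_fin (n : ℕ) :
    (∏ k ∈ range n, (1 - q^(2*k+1))) * (∑ k ∈ range (2*n+1), q^(k*(k+1)/2))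
    = ∑ s ∈ range (n+1), (∏ k ∈ range s, (1 - q^(2*k+1))) * (∏ k ∈ Ico s n, (1 - q^(2*(k+1)))) * q^(s*(2*n+1)) := by
  induction n with
  | zero => simp
  | succ n ih =>
    have h1 : (2*n+1)*(2*n+1+1)/2 = (n+1)*(2*n+1) := by
      apply Nat.div_eq_of_eq_mul_left two_pos; ring
    have h2 : (2*n+1+1)*(2*n+1+1+1)/2 = (n+1)*(2*(n+1)+1) := by
      apply Nat.div_eq_of_eq_mul_left two_pos; ring
    rw [sum_range_succ _ (n+1), show 2*(n+1)+1 = 2*n+3 by ring, psi_partial q n n le_rfl, ← ih,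
      prod_range_succ, show 2*n+3 = 2*n+1+1+1 by ring, sum_range_succ _ (2*n+1+1),
      sum_range_succ _ (2*n+1), h1, h2]
    simp
    ring

theorem psi_fin' (n : ℕ) : ∃ g : R,
    (∏ k ∈ range n, (1 - q^(2*k+1))) * (∑ k ∈ range (2*n+1), q^(k*(k+1)/2))
    = (∏ k ∈ range n, (1 - q^(2*(k+1)))) + q^(n+1) * g := by
  refine ⟨∑ s ∈ range n, (∏ k ∈ range (s+1), (1 - q^(2*k+1))) * (∏ k ∈ Ico (s+1) n, (1 - q^(2*(k+1)))) * q^(s*(2*n+1)+n), ?_⟩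
  rw [psi_fin, sum_range_succ', add_comm, mul_sum]
  congr 1
  · simp
  · apply sum_congr rfl; intros; ring

theorem prod_split (n : ℕ) : ∏ k ∈ range (2*n), (1 - q^(k+1)) =
    (∏ k ∈ range n, (1 - q^(2*k+1))) * (∏ k ∈ range n, (1 - q^(2*(k+1)))) := by
  induction n with
  | zero => simp
  | succ n ih =>
    rw [show 2*(n+1) = 2*n+1+1 by ring, prod_range_succ, prod_range_succ, ih, prod_range_succ,
      prod_range_succ]
    ring

theorem prod_sq (n : ℕ) : (∏ k ∈ range n, (1 - q^(k+1))) * (∏ k ∈ range n, (1 + q^(k+1))) =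
    (∏ k ∈ range n, (1 - q^(2*(k+1)))) := by
  rw [← prod_mul_distrib]
  apply prod_congr rfl; intros; ring

theorem phi_fin2 (n : ℕ) : ∃ g : R,
    (∏ k ∈ range n, (1 - q^(2*(k+1)))) * (1 + ∑ k ∈ range n, 2 * (-1)^(k+1) * q^((k+1)^2))
    = (∏ k ∈ range n, (1 - q^(k+1)))^2 + q^(n+1) * g := by
  obtain ⟨g, hg⟩ := phi_fin' q n
  refine ⟨(∏ k ∈ range n, (1 - q^(k+1))) * g, ?_⟩
  rw [← prod_sq, mul_assoc, hg]; ring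

theorem psi_fin2 (n : ℕ) : ∃ g : R,
    (∏ k ∈ range (2*n), (1 - q^(k+1))) * (∑ k ∈ range (2*n+1), q^(k*(k+1)/2))
    = (∏ k ∈ range n, (1 - q^(2*(k+1))))^2 + q^(n+1) * g := by
  obtain ⟨g, hg⟩ := psi_fin' q n
  refine ⟨(∏ k ∈ range n, (1 - q^(2*(k+1)))) * g, ?_⟩
  rw [prod_split, mul_comm (∏ k ∈ range n, (1 - q^(2*k+1))), mul_assoc, hg]; ring

end fin
end CP
namespace CP
open Finset PowerSeries

section comb

/-- multisets of positive parts satisfying `p` with sum `n` -/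
def parts (p : ℕ → Prop) [DecidablePred p] (n : ℕ) : Finset (Multiset ℕ) :=
  (Nat.Partition.restricted n p).image Nat.Partition.parts

theorem mem_parts (p : ℕ → Prop) [DecidablePred p] (n : ℕ) (m : Multiset ℕ) :
    m ∈ parts p n ↔ (∀ x ∈ m, 0 < x) ∧ (∀ x ∈ m, p x) ∧ m.sum = n := by
  simp only [parts, Nat.Partition.restricted, mem_image, mem_filter, mem_univ, true_and]
  constructor
  · rintro ⟨P, hP, rfl⟩
    exact ⟨fun x hx => P.parts_pos hx, hP, P.parts_sum⟩
  · rintro ⟨h1, h2, h3⟩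
    exact ⟨⟨m, fun {x} hx => h1 x hx, h3⟩, h2, rfl⟩

theorem card_parts (p : ℕ → Prop) [DecidablePred p] (n : ℕ) :
    (parts p n).card = (Nat.Partition.restricted n p).card := by
  apply card_image_of_injective
  intro a b h
  exact Nat.Partition.ext h

/-- generating function -/
noncomputable def gf (p : ℕ → Prop) [DecidablePred p] : (ZMod 3)⟦X⟧ :=
  PowerSeries.mk fun n ↦ ((Nat.Partition.restricted n p).card : ZMod 3)

theorem colored_gf (k n : ℕ) :
    (coloredPartition (k+1) n : ZMod 3) = coeff n (gf (fun _ => True) * gf Odd ^ k) := by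
  classical
  let Q : Fin (k+1) → ℕ → Prop := fun i x => i ≠ 0 → Odd x
  have h1 : {c : Fin (k+1) → Multiset ℕ |
    (∀ i, ∀ x ∈ c i, 0 < x) ∧
    (∀ i : Fin (k+1), i.val ≠ 0 → ∀ x ∈ c i, Odd x) ∧
    (∑ i, (c i).sum) = n} =
    (((finsuppAntidiag (univ : Finset (Fin (k+1))) n).biUnion
      (fun l => Fintype.piFinset (fun i => parts (Q i) (l i))) : Finset (Fin (k+1) → Multiset ℕ)) : Set (Fin (k+1) → Multiset ℕ)) := by
    ext c
    simp only [Set.mem_ofPred_eq, coe_biUnion, Set.mem_iUnion, mem_coe, Fintype.mem_piFinset,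
      mem_parts, mem_finsuppAntidiag, exists_prop, Q]
    constructor
    · rintro ⟨ha, hb, hc⟩
      refine ⟨Finsupp.equivFunOnFinite.symm (fun i => (c i).sum), ⟨by simpa using hc, by simp⟩, ?_⟩
      intro i
      refine ⟨ha i, fun x hx hi => hb i (fun h => hi (Fin.ext h)) x hx, by simp⟩
    · rintro ⟨l, ⟨hl, -⟩, h⟩
      refine ⟨fun i => (h i).1, fun i hi x hx => (h i).2.1 x hx (fun h => hi (by rw [h]; rfl)), ?_⟩
      rw [← hl]
      exact sum_congr rfl fun i _ => (h i).2.2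
  have h2 : gf (fun _ => True) * gf Odd ^ k = ∏ i : Fin (k+1), gf (Q i) := by
    rw [Fin.prod_univ_succ]
    congr 1
    · simp [Q, gf]
    · have : ∀ i : Fin k, gf (Q i.succ) = gf Odd := by
        intro i; simp [Q, gf, Fin.succ_ne_zero]
      simp [this]
  rw [coloredPartition, h1, Set.ncard_coe_finset, card_biUnion, h2, coeff_prod]
  · simp [Fintype.card_piFinset, card_parts, gf]
  · intro l _ l' _ hne
    rw [Function.onFun, Finset.disjoint_left]
    intro c hc hc'
    apply hne
    ext i
    simp only [Fintype.mem_piFinset, mem_parts] at hc hc'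
    rw [← (hc i).2.2, ← (hc' i).2.2]

end comb

end CP
namespace CP
open Finset PowerSeries

section alg

/-- power series over the field with three elements -/
abbrev K := PowerSeries (ZMod 3)

theorem cube_expand (f : K) : f ^ 3 = PowerSeries.expand 3 (by norm_num) f := by
  have h : frobenius (ZMod 3) 3 = RingHom.id _ := ZMod.frobenius_zmod 3
  have := MvPowerSeries.map_frobenius_expand (σ := Unit) (R := ZMod 3) 3 (by norm_num) (f := f)
  rw [h] at this
  rw [PowerSeries.expand, ← this]
  simp [MvPowerSeries.map_id]

theorem coeff_cube (f : K) (n : ℕ) : coeff (3 * n) (f ^ 3) = coeff n f := by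
  rw [cube_expand, coeff_expand_mul]

theorem coeff_cube_not (f : K) (n : ℕ) (h : n % 3 ≠ 0) : coeff n (f ^ 3) = 0 := by
  rw [cube_expand, coeff_expand_of_not_dvd]
  omega

/-- `f` is supported in the residue class `r` modulo 3 -/
def Res (r : ℕ) (f : K) : Prop := ∀ n, n % 3 ≠ r → coeff n f = 0

theorem Res.mul {r s : ℕ} {f g : K} (hf : Res r f) (hg : Res s g) : Res ((r + s) % 3) (f * g) := by
  intro n hn
  rw [coeff_mul]
  apply sum_eq_zero
  rintro ⟨a, b⟩ hab
  rw [Finset.HasAntidiagonal.mem_antidiagonal] at hab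
  simp only at hab ⊢
  by_cases h1 : a % 3 = r
  · by_cases h2 : b % 3 = s
    · exfalso; apply hn; omega
    · rw [hg b h2, mul_zero]
  · rw [hf a h1, zero_mul]

theorem res_cube (f : K) : Res 0 (f ^ 3) := fun n hn => coeff_cube_not f n hn

theorem coeff_congr_cube {r : ℕ} {f f' : K} (h : ∀ n, n % 3 = r → coeff n f = coeff n f')
    (g : K) (N : ℕ) (hN : N % 3 = r) : coeff N (f * g ^ 3) = coeff N (f' * g ^ 3) := by
  rw [coeff_mul, coeff_mul]
  apply sum_congr rfl
  rintro ⟨a, b⟩ hab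
  rw [Finset.HasAntidiagonal.mem_antidiagonal] at hab
  simp only at hab ⊢
  by_cases h2 : b % 3 = 0
  · rw [h a (by omega)]
  · rw [coeff_cube_not g b h2, mul_zero, mul_zero]

/-- theta function `φ(-q)` -/
noncomputable def phi : K := PowerSeries.mk fun n =>
  if IsSquare n then (if n = 0 then 1 else 2 * (-1) ^ n) else 0

/-- theta function `ψ(q)` -/
noncomputable def psi : K := PowerSeries.mk fun n => if IsSquare (8 * n + 1) then 1 else 0

theorem sq_mod (n : ℕ) : (n * n) % 3 ≠ 2 := by
  rw [Nat.mul_mod]; have := Nat.mod_lt n (show 3 > 0 by norm_num)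
  interval_cases n % 3 <;> norm_num

theorem sq_three {m : ℕ} (h : IsSquare (3 * m)) : ∃ k, m = 3 * k := by
  obtain ⟨r, hr⟩ := h
  have : 3 ∣ r := by
    have h3 : 3 ∣ r * r := ⟨m, hr.symm⟩
    exact (Nat.Prime.dvd_mul Nat.prime_three).1 h3 |>.elim id id
  obtain ⟨s, rfl⟩ := this
  exact ⟨s * s, by nlinarith⟩

theorem sq_nine (m : ℕ) : IsSquare (9 * m) ↔ IsSquare m := by
  constructor
  · rintro ⟨r, hr⟩
    have : 3 ∣ r := by
      have h3 : 3 ∣ r * r := ⟨3 * m, by rw [← hr]; ring⟩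
      exact (Nat.Prime.dvd_mul Nat.prime_three).1 h3 |>.elim id id
    obtain ⟨s, rfl⟩ := this
    exact ⟨s, by nlinarith⟩
  · rintro ⟨r, rfl⟩
    exact ⟨3 * r, by ring⟩

theorem coeff_ninth (f : K) (n : ℕ) : coeff (9 * n) (f ^ 9) = coeff n f := by
  rw [show f ^ 9 = (f ^ 3) ^ 3 by ring, show 9 * n = 3 * (3 * n) by ring, coeff_cube, coeff_cube]

theorem coeff_ninth_not (f : K) (n : ℕ) (h : n % 9 ≠ 0) : coeff n (f ^ 9) = 0 := by
  rw [show f ^ 9 = (f ^ 3) ^ 3 by ring]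
  by_cases h3 : n % 3 = 0
  · rw [show n = 3 * (n / 3) by omega, coeff_cube, coeff_cube_not]
    omega
  · exact coeff_cube_not _ _ h3

theorem phi_dissect : Res 1 (phi - phi ^ 9) := by
  intro n hn
  rw [map_sub, sub_eq_zero]
  by_cases h9 : n % 9 = 0
  · obtain ⟨m, rfl⟩ : ∃ m, n = 9 * m := ⟨n / 9, by omega⟩
    rw [coeff_ninth]
    have : ((-1 : ZMod 3)) ^ (9 * m) = (-1) ^ m := by rw [pow_mul]; congr 1
    simp [phi, sq_nine, this]
  · rw [coeff_ninth_not _ _ h9]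
    simp only [phi, coeff_mk]
    rw [if_neg]
    intro hs
    by_cases h3 : n % 3 = 0
    · obtain ⟨m, rfl⟩ : ∃ m, n = 3 * m := ⟨n / 3, by omega⟩
      obtain ⟨k, rfl⟩ := sq_three hs
      omega
    · obtain ⟨r, rfl⟩ := hs
      have := sq_mod r
      omega

theorem psi_dissect : Res 0 (psi - X * psi ^ 9) := by
  intro n hn
  rw [map_sub, sub_eq_zero]
  obtain _ | n := n
  · simp at hn
  rw [mul_comm, coeff_succ_mul_X]
  by_cases h9 : n % 9 = 0
  · obtain ⟨m, rfl⟩ : ∃ m, n = 9 * m := ⟨n / 9, by omega⟩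
    rw [coeff_ninth]
    have : 8 * (9 * m + 1) + 1 = 9 * (8 * m + 1) := by ring
    simp [psi, this, sq_nine]
  · rw [coeff_ninth_not _ _ h9]
    simp only [psi, coeff_mk]
    rw [if_neg]
    intro hs
    by_cases h3 : n % 3 = 0
    · obtain ⟨m, rfl⟩ : ∃ m, n = 3 * m := ⟨n / 3, by omega⟩
      rw [show 8 * (3 * m + 1) + 1 = 3 * (8 * m + 3) by ring] at hs
      obtain ⟨k, hk⟩ := sq_three hs
      omega
    · obtain ⟨r, hr⟩ := hs
      have := sq_mod r
      obtain ⟨c, rfl⟩ : ∃ c, n = 3 * c + 1 := ⟨n / 3, by omega⟩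
      omega

theorem three_zero : (3 : K) = 0 := by
  have h : (3 : ZMod 3) = 0 := by decide
  calc (3 : K) = C (3 : ZMod 3) := (map_ofNat (C (R := ZMod 3)) 3).symm
    _ = C 0 := by rw [h]
    _ = 0 := map_zero _

theorem phi_ne : phi ≠ 0 := by
  intro h
  have := congrArg (coeff 0) h
  simp [phi] at this

/-- key relation, from `ψ φ² = E³` -/
theorem cross {e : K} (he : psi * phi ^ 2 = e ^ 3) :
    (psi - X * psi ^ 9) * (phi - phi ^ 9) = X * psi ^ 9 * phi ^ 9 := by
  have hA := psi_dissect
  have hb := phi_dissect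
  have ha : Res 0 (phi ^ 9) := by
    rw [show phi ^ 9 = (phi ^ 3) ^ 3 by ring]; exact res_cube _
  have hp : Res 0 (psi ^ 9) := by
    rw [show psi ^ 9 = (psi ^ 3) ^ 3 by ring]; exact res_cube _
  have hX : Res 1 (X : K) := by
    intro n hn
    rw [coeff_X, if_neg]; rintro rfl; simp at hn
  have hB := hX.mul hp
  simp only [Nat.reduceAdd, Nat.reduceMod] at hB
  set A := psi - X * psi ^ 9 with hAd
  set b := phi - phi ^ 9 with hbd
  set a := phi ^ 9 with had
  set B := X * psi ^ 9 with hBd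
  have e1 : psi = A + B := by rw [hAd]; ring
  have e2 : phi = a + b := by rw [hbd]; ring
  have ane : a ≠ 0 := pow_ne_zero _ phi_ne
  have key : (2 * A * b + B * a) * a = 0 := by
    have h1 := (hA.mul hb).mul ha
    have h2 := (hB.mul ha).mul ha
    have h3 := (hA.mul ha).mul ha
    have h4 := (hA.mul hb).mul hb
    have h5 := (hB.mul ha).mul hb
    have h6 := (hB.mul hb).mul hb
    simp only [Nat.reduceAdd, Nat.reduceMod] at h1 h2 h3 h4 h5 h6
    have ex : (2 * A * b + B * a) * a = A * b * a + A * b * a + B * a * a := by ring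
    ext n
    rw [ex, map_zero]
    by_cases hn : n % 3 = 1
    · have hc := res_cube e n (by omega)
      rw [← he, e1, e2, show (A + B) * (a + b) ^ 2 = (A * b * a + A * b * a + B * a * a) + A * a * a
        + A * b * b + B * a * b + B * a * b + B * b * b by ring] at hc
      simp only [map_add] at hc ⊢
      rw [h3 n (by omega), h4 n (by omega), h5 n (by omega), h6 n (by omega)] at hc
      simpa using hc
    · simp only [map_add]
      rw [h1 n hn, h2 n hn]; simp
  have k2 := (mul_eq_zero.1 key).resolve_right ane
  linear_combination (-1) * k2 + (A * b) * three_zero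

theorem dissect {e : K} (he : psi * phi ^ 2 = e ^ 3) (r : ℕ) (hr : r ≤ 2) :
    ∃ ε : ZMod 3, ∀ n, n % 3 = r →
      coeff n (psi ^ r * phi ^ (2 - r)) = coeff n (C ε * (X ^ r * (psi ^ r * phi ^ (2 - r)) ^ 9)) := by
  have hA := psi_dissect
  have hb := phi_dissect
  have ha : Res 0 (phi ^ 9) := by
    rw [show phi ^ 9 = (phi ^ 3) ^ 3 by ring]; exact res_cube _
  have hp : Res 0 (psi ^ 9) := by
    rw [show psi ^ 9 = (psi ^ 3) ^ 3 by ring]; exact res_cube _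
  have hX : Res 1 (X : K) := by
    intro n hn
    rw [coeff_X, if_neg]; rintro rfl; simp at hn
  have hB := hX.mul hp
  simp only [Nat.reduceAdd, Nat.reduceMod] at hB
  have hcr := cross he
  set A := psi - X * psi ^ 9 with hAd
  set b := phi - phi ^ 9 with hbd
  have e1 : psi = A + X * psi ^ 9 := by rw [hAd]; ring
  have e2 : phi = phi ^ 9 + b := by rw [hbd]; ring
  interval_cases r
  · refine ⟨1, fun n hn => ?_⟩
    have h1 := ha.mul hb
    have h2 := hb.mul hb
    simp only [Nat.reduceAdd, Nat.reduceMod] at h1 h2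
    have : psi ^ 0 * phi ^ (2 - 0) = C 1 * (X ^ 0 * (psi ^ 0 * phi ^ (2 - 0)) ^ 9) +
       phi ^ 9 * b + phi ^ 9 * b + b * b := by
      rw [map_one, hbd]; ring
    have h3 := congrArg (coeff n) this
    rw [map_add, map_add, map_add, h1 n (by omega), h2 n (by omega)] at h3
    simpa using h3
  · refine ⟨-1, fun n hn => ?_⟩
    have h1 := hA.mul ha
    have h2 := hB.mul hb
    simp only [Nat.reduceAdd, Nat.reduceMod] at h1 h2
    have : psi ^ 1 * phi ^ (2 - 1) = C (-1) * (X ^ 1 * (psi ^ 1 * phi ^ (2 - 1)) ^ 9) +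
       A * phi ^ 9 + X * psi ^ 9 * b := by
      rw [map_neg, map_one]
      have h4 : psi ^ 1 * phi ^ (2 - 1) = A * phi ^ 9 + A * b + X * psi ^ 9 * phi ^ 9 + X * psi ^ 9 * b := by
        rw [hAd, hbd]; ring
      linear_combination h4 + hcr + (X * psi ^ 9 * phi ^ 9) * three_zero
    have h3 := congrArg (coeff n) this
    rw [map_add, map_add, h1 n (by omega), h2 n (by omega)] at h3
    simpa using h3
  · refine ⟨1, fun n hn => ?_⟩
    have h1 := hA.mul hA
    have h2 := hA.mul hB
    simp only [Nat.reduceAdd, Nat.reduceMod] at h1 h2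
    have : psi ^ 2 * phi ^ (2 - 2) = C 1 * (X ^ 2 * (psi ^ 2 * phi ^ (2 - 2)) ^ 9) +
       A * A + A * (X * psi ^ 9) + A * (X * psi ^ 9) := by
      rw [map_one, hAd]; ring
    have h3 := congrArg (coeff n) this
    rw [map_add, map_add, map_add, h1 n (by omega), h2 n (by omega)] at h3
    simpa using h3

theorem coeff_C_X {ε : ZMod 3} (r : ℕ) (f g : K) (n : ℕ) :
    coeff (n + r) (C ε * (X ^ r * f) * g) = ε * coeff n (f * g) := by
  rw [show C ε * (X ^ r * f) * g = C ε * (X ^ r * (f * g)) by ring, coeff_C_mul, coeff_X_pow_mul]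

theorem coeff_mul_cube_zero {f g : K} {r : ℕ} (h : ∀ n, n % 3 = r → coeff n f = 0) (N : ℕ)
    (hN : N % 3 = r) : coeff N (f * g ^ 3) = 0 := by
  rw [coeff_congr_cube (f' := 0) (fun n hn => by simp [h n hn]) g N hN]; simp

theorem phi_two (n : ℕ) (hn : n % 3 = 2) : coeff n phi = 0 := by
  have h := phi_dissect n (by omega)
  rw [map_sub, coeff_ninth_not _ _ (by omega), sub_zero] at h
  exact h

theorem psi_two (n : ℕ) (hn : n % 3 = 2) : coeff n psi = 0 := by
  simp only [psi, coeff_mk]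
  rw [if_neg]
  rintro ⟨r, hr⟩
  have := sq_mod r
  omega

theorem last {e : K} (he : psi * phi ^ 2 = e ^ 3) (r : ℕ) (hr : r ≤ 2) (n : ℕ) (hn : n % 3 = 2) :
    coeff n (psi ^ r * phi ^ (2 - r) * phi ^ 2) = 0 := by
  interval_cases r
  · rw [show psi ^ 0 * phi ^ (2 - 0) * phi ^ 2 = phi * phi ^ 3 by ring]
    exact coeff_mul_cube_zero phi_two n hn
  · rw [show psi ^ 1 * phi ^ (2 - 1) * phi ^ 2 = psi * phi ^ 3 by ring]
    exact coeff_mul_cube_zero psi_two n hn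
  · rw [show psi ^ 2 * phi ^ (2 - 2) * phi ^ 2 = psi * (psi * phi ^ 2) by ring, he]
    exact coeff_mul_cube_zero psi_two n hn

theorem main_coeff {e : K} (he : psi * phi ^ 2 = e ^ 3) (r s : ℕ) (hr : r ≤ 2) (hs : s ≤ 2)
    (Y : K) (n : ℕ) :
    coeff (27 * n + 18 + (3 * s + r)) (psi ^ (3 * s + r) * phi ^ (26 - (3 * s + r)) * Y ^ 27) = 0 := by
  obtain ⟨ε, hε⟩ := dissect he r hr
  obtain ⟨δ, hδ⟩ := dissect he s hs
  have hl := last he r hr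
  have e0 : psi ^ (3 * s + r) * phi ^ (26 - (3 * s + r)) * Y ^ 27 =
      (psi ^ r * phi ^ (2 - r)) * ((psi ^ s * phi ^ (2 - s)) * (phi ^ 2 * Y ^ 3) ^ 3) ^ 3 := by
    rw [show 26 - (3 * s + r) = (2 - r) + 3 * (2 - s) + 18 by omega]
    ring
  generalize psi ^ r * phi ^ (2 - r) = F at *
  generalize psi ^ s * phi ^ (2 - s) = G at *
  rw [e0, coeff_congr_cube hε _ _ (by omega),
    show 27 * n + 18 + (3 * s + r) = 3 * (9 * n + 6 + s) + r by ring, coeff_C_X,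
    show F ^ 9 * (G * (phi ^ 2 * Y ^ 3) ^ 3) ^ 3 = (G * (F * phi ^ 2 * Y ^ 3) ^ 3) ^ 3 by ring,
    coeff_cube, coeff_congr_cube hδ _ _ (by omega),
    show 9 * n + 6 + s = 3 * (3 * n + 2) + s by ring, coeff_C_X,
    show G ^ 9 * (F * phi ^ 2 * Y ^ 3) ^ 3 = (F * phi ^ 2 * (G * Y) ^ 3) ^ 3 by ring, coeff_cube,
    coeff_mul_cube_zero hl _ (by omega)]
  simp

end alg
end CP

namespace CP
open Finset PowerSeries Filter Topology
open scoped PowerSeries.WithPiTopology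

section lim

/-- Euler product -/
noncomputable def E1 : K := ∏' i, (1 - X ^ (i + 1))

theorem tendsto_E1 : Tendsto (fun n => ∏ k ∈ range n, (1 - (X : K) ^ (k + 1))) atTop (𝓝 E1) :=
  (WithPiTopology.multipliable_one_sub_X_pow (ZMod 3)).hasProd.tendsto_prod_nat

theorem tendsto_gf (p : ℕ → Prop) [DecidablePred p] :
    Tendsto (fun n => ∏ i ∈ range n, (if p (i + 1) then ∑' j : ℕ, (X : K) ^ ((i + 1) * j) else 1))
      atTop (𝓝 (gf p)) :=
  (Nat.Partition.hasProd_powerSeriesMk_card_restricted (ZMod 3) p).tendsto_prod_nat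

theorem geom (i : ℕ) : (∑' j : ℕ, (X : K) ^ ((i + 1) * j)) * (1 - X ^ (i + 1)) = 1 := by
  simp_rw [pow_mul]
  exact WithPiTopology.tsum_pow_mul_one_sub_of_constantCoeff_eq_zero (by simp)

theorem gf_true : gf (fun _ => True) * E1 = 1 := by
  refine tendsto_nhds_unique ((tendsto_gf (fun _ => True)).mul tendsto_E1) ?_
  simp_rw [← prod_mul_distrib, if_true, geom]
  simp

/-- the product over even exponents -/
noncomputable def E2 : K := gf Odd * E1

theorem tendsto_two : Tendsto (fun n : ℕ => 2 * n) atTop atTop :=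
  tendsto_atTop_mono (fun n => by simp only [id]; omega) tendsto_id

theorem tendsto_E2 : Tendsto (fun n => ∏ k ∈ range n, (1 - (X : K) ^ (2 * (k + 1)))) atTop (𝓝 E2) := by
  have h := ((tendsto_gf Odd).mul tendsto_E1).comp tendsto_two
  refine h.congr fun n => ?_
  simp only [Function.comp]
  rw [← prod_mul_distrib]
  induction n with
  | zero => simp
  | succ n ih =>
    rw [show 2 * (n + 1) = 2 * n + 1 + 1 by ring, prod_range_succ, prod_range_succ, ih,
      prod_range_succ, if_pos (by simp), if_neg (by simp [parity_simps]), geom, one_mul, mul_one]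
    ring

theorem tendsto_rem (g : ℕ → K) : Tendsto (fun n => X ^ (n + 1) * g n) atTop (𝓝 0) := by
  rw [WithPiTopology.tendsto_iff_coeff_tendsto]
  intro d
  refine tendsto_atTop_of_eventually_const (i₀ := d) fun n hn => ?_
  rw [coeff_X_pow_mul', if_neg (by omega), map_zero]

theorem tendsto_psi : Tendsto (fun n => ∑ k ∈ range (2 * n + 1), (X : K) ^ (k * (k + 1) / 2)) atTop (𝓝 psi) := by
  rw [WithPiTopology.tendsto_iff_coeff_tendsto]
  intro d
  refine tendsto_atTop_of_eventually_const (i₀ := d) fun n hn => ?_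
  simp only [map_sum, coeff_X_pow, psi, coeff_mk]
  have hdiv : ∀ k : ℕ, 2 * (k * (k + 1) / 2) = k * (k + 1) := fun k =>
    Nat.mul_div_cancel' (Nat.even_mul_succ_self k).two_dvd
  split_ifs with h
  · obtain ⟨r, hr⟩ := h
    have hodd : r % 2 = 1 := by
      by_contra hc
      obtain ⟨s, rfl⟩ : ∃ s, r = 2 * s := ⟨r / 2, by omega⟩
      have : 2 * s * (2 * s) = 4 * (s * s) := by ring
      omega
    obtain ⟨s, rfl⟩ : ∃ s, r = 2 * s + 1 := ⟨r / 2, by omega⟩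
    have hd : d = s * (s + 1) / 2 := by
      have := hdiv s
      have h2 : (2 * s + 1) * (2 * s + 1) = 4 * (s * (s + 1)) + 1 := by ring
      omega
    rw [sum_eq_single s, if_pos hd]
    · intro b _ hb
      rw [if_neg]
      intro hdb
      have h1 := hdiv s
      have h2 := hdiv b
      apply hb
      have : b * (b + 1) = s * (s + 1) := by omega
      nlinarith
    · intro hs
      exfalso
      apply hs
      rw [mem_range]
      have := hdiv s
      nlinarith
  · apply sum_eq_zero
    intro k _
    rw [if_neg]
    intro hd
    apply h
    have := hdiv k
    exact ⟨2 * k + 1, by rw [hd]; nlinarith⟩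

theorem tendsto_phi : Tendsto (fun n => 1 + ∑ k ∈ range n, 2 * (-1) ^ (k + 1) * (X : K) ^ ((k + 1) ^ 2))
    atTop (𝓝 phi) := by
  rw [WithPiTopology.tendsto_iff_coeff_tendsto]
  intro d
  refine tendsto_atTop_of_eventually_const (i₀ := d) fun n hn => ?_
  have hc : ∀ k : ℕ, coeff d (2 * (-1) ^ (k + 1) * (X : K) ^ ((k + 1) ^ 2)) =
      if d = (k + 1) ^ 2 then 2 * (-1) ^ (k + 1) else 0 := by
    intro k
    have : (2 * (-1) ^ (k + 1) * (X : K) ^ ((k + 1) ^ 2)) =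
      C (2 * (-1) ^ (k + 1) : ZMod 3) * (X : K) ^ ((k + 1) ^ 2) := by
      rw [map_mul, map_pow, map_neg, map_one, map_ofNat]
    rw [this, coeff_C_mul, coeff_X_pow]
    simp
  simp only [map_add, map_sum, hc, phi, coeff_mk, coeff_one]
  by_cases h0 : d = 0
  · subst h0
    have h1 : ∀ x : ℕ, 0 ≠ (x + 1) ^ 2 := fun x => (by positivity : 0 < (x + 1) ^ 2).ne
    simp [h1]
  rw [if_neg h0, if_neg h0, zero_add]
  split_ifs with h
  · obtain ⟨r, hr⟩ := h
    obtain _ | s := r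
    · omega
    rw [sum_eq_single s, if_pos (by rw [hr]; ring), hr]
    · congr 1
      rw [pow_mul]
      rcases Nat.even_or_odd (s + 1) with h | h
      · rw [h.neg_one_pow, one_pow]
      · rw [h.neg_one_pow, h.neg_one_pow]
    · intro b _ hb
      rw [if_neg]
      intro hdb
      apply hb
      nlinarith
    · intro hs
      exfalso
      apply hs
      rw [mem_range]
      nlinarith
  · apply sum_eq_zero
    intro k _
    rw [if_neg]
    intro hd
    exact h ⟨k + 1, by rw [hd]; ring⟩

theorem phi_prod : E2 * phi = E1 ^ 2 := by
  choose g hg using fun n => phi_fin2 (X : K) n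
  refine tendsto_nhds_unique (tendsto_E2.mul tendsto_phi) ?_
  simp_rw [hg]
  simpa using (tendsto_E1.pow 2).add (tendsto_rem g)

theorem psi_prod : E1 * psi = E2 ^ 2 := by
  choose g hg using fun n => psi_fin2 (X : K) n
  refine tendsto_nhds_unique ((tendsto_E1.comp tendsto_two).mul tendsto_psi) ?_
  simp only [Function.comp]
  simp_rw [hg]
  simpa using (tendsto_E2.pow 2).add (tendsto_rem g)

end lim

theorem E1_ne : E1 ≠ 0 := right_ne_zero_of_mul_eq_one gf_true

theorem E2_ne : E2 ≠ 0 := by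
  intro h
  have := phi_prod
  rw [h, zero_mul] at this
  exact pow_ne_zero 2 E1_ne this.symm

theorem psi_phi : psi * phi ^ 2 = E1 ^ 3 := by
  apply mul_left_cancel₀ (mul_ne_zero E1_ne (pow_ne_zero 2 E2_ne))
  linear_combination (E2 ^ 2 * phi ^ 2) * psi_prod + E2 ^ 2 * (E2 * phi + E1 ^ 2) * phi_prod

theorem gen_eq (j t : ℕ) (ht : t ≤ 8) :
    gf (fun _ => True) * gf Odd ^ (27 * j + 3 * t + 1) =
      psi ^ t * phi ^ (26 - t) * (gf Odd ^ j * (E2 * gf (fun _ => True) ^ 2)) ^ 27 := by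
  have hP := gf_true
  have hH : gf Odd = E2 * gf (fun _ => True) := by
    rw [E2, mul_assoc, mul_comm E1, hP, mul_one]
  set P := gf (fun _ => True)
  set H := gf Odd
  have h1 : phi * (E2 * P ^ 2) = 1 := by
    linear_combination P ^ 2 * phi_prod + (P * E1 + 1) * hP
  have h2 : psi * (E2 * P ^ 2) = H ^ 3 := by
    rw [hH]
    linear_combination (E2 * P ^ 3) * psi_prod - (psi * E2 * P ^ 2) * hP
  obtain ⟨u, hu⟩ : ∃ u, u = E2 * P ^ 2 := ⟨_, rfl⟩
  rw [← hu] at h1 h2 ⊢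
  have h3 : P * H = u := by rw [hH, hu]; ring
  calc P * H ^ (27 * j + 3 * t + 1) = (H ^ j) ^ 27 * (H ^ 3) ^ t * (P * H) := by ring
    _ = (H ^ j) ^ 27 * (psi * u) ^ t * u * (phi * u) ^ (26 - t) := by
        rw [h3, ← h2, h1, one_pow, mul_one]
    _ = psi ^ t * phi ^ (26 - t) * (H ^ j) ^ 27 * (u ^ t * u * u ^ (26 - t)) := by
        rw [mul_pow, mul_pow]; ring
    _ = psi ^ t * phi ^ (26 - t) * (H ^ j * u) ^ 27 := by
        rw [← pow_succ, ← pow_add, show t + 1 + (26 - t) = 27 by omega]; ring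

end CP

/-- For all `j ≥ 0`, `0 ≤ t ≤ 8` and all `n ≥ 0`,
`a_{27j+3t+2}(27n + 18 + t) ≡ 0 (mod 3)`. -/
theorem coloredPartition_27j_add_3t_add_2_congr (j t n : ℕ) (ht : t ≤ 8) :
    3 ∣ coloredPartition (27 * j + 3 * t + 2) (27 * n + 18 + t) := by
  rw [← ZMod.natCast_eq_zero_iff, CP.colored_gf, CP.gen_eq j t ht]
  obtain ⟨r, s, hr, hs, rfl⟩ : ∃ r s, r ≤ 2 ∧ s ≤ 2 ∧ t = 3 * s + r :=
    ⟨t % 3, t / 3, by omega, by omega, by omega⟩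
  exact CP.main_coeff CP.psi_phi r s hr hs _ n
end

section
/- For all integers n ≥ 0 and k ≥ 0, the number a_5(3^{2k+3} n + (153·3^{2k} − 1)/8) is divisible by 3. (Here 153·3^{2k} ≡ 1 (mod 8), so the argument is an integer.) -/
open Finset
theorem cp_shanks_psi_aux {A : Type*} [CommRing A] (q : A) (n : ℕ) (m : ℕ) (hm : m ≤ n) :
    ∑ s ∈ range m, (∏ i ∈ Ico s n, (1 - q ^ (2 * i + 2))) * (∏ i ∈ range s, (1 - q ^ (2 * i + 1))) *
      q ^ (s * (2 * n + 1)) * ((1 - q ^ (2 * n + 2)) * q ^ (2 * s) - (1 - q ^ (2 * n + 1)))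
    = (1 - q ^ (2 * m)) * (∏ i ∈ Ico m n, (1 - q ^ (2 * i + 2))) *
      (∏ i ∈ range m, (1 - q ^ (2 * i + 1))) * q ^ (m * (2 * n + 1)) := by
  induction m with
  | zero => simp
  | succ m ih =>
    rw [sum_range_succ, ih (by omega), prod_range_succ, prod_eq_prod_Ico_succ_bot (show m < n by omega)]
    ring

theorem cp_shanks_psi {A : Type*} [CommRing A] (q : A) (n : ℕ) :
    (∏ i ∈ range n, (1 - q ^ (2 * i + 1))) * ∑ s ∈ range (2 * n), q ^ (s * (s + 1) / 2) =
    ∑ s ∈ range n, (∏ i ∈ Ico s n, (1 - q ^ (2 * i + 2))) * (∏ i ∈ range s, (1 - q ^ (2 * i + 1))) *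
      q ^ (s * (2 * n + 1)) := by
  induction n with
  | zero => simp
  | succ n ih =>
    have h1 : (2 * n) * (2 * n + 1) / 2 = n * (2 * n + 1) := by
      rw [mul_assoc]; exact Nat.mul_div_cancel_left _ (by norm_num)
    have h2 : (2 * n + 1) * (2 * n + 1 + 1) / 2 = (n + 1) * (2 * n + 1) := by
      rw [show (2 * n + 1) * (2 * n + 1 + 1) = 2 * ((n + 1) * (2 * n + 1)) by ring]
      exact Nat.mul_div_cancel_left _ (by norm_num)
    have key := cp_shanks_psi_aux q n n le_rfl
    have e : ∀ s ∈ range n, (∏ i ∈ Ico s (n + 1), (1 - q ^ (2 * i + 2))) *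
        (∏ i ∈ range s, (1 - q ^ (2 * i + 1))) * q ^ (s * (2 * (n + 1) + 1)) =
        (∏ i ∈ Ico s n, (1 - q ^ (2 * i + 2))) * (∏ i ∈ range s, (1 - q ^ (2 * i + 1))) *
        q ^ (s * (2 * n + 1)) * ((1 - q ^ (2 * n + 2)) * q ^ (2 * s) - (1 - q ^ (2 * n + 1))) +
        (1 - q ^ (2 * n + 1)) * ((∏ i ∈ Ico s n, (1 - q ^ (2 * i + 2))) *
        (∏ i ∈ range s, (1 - q ^ (2 * i + 1))) * q ^ (s * (2 * n + 1))) := by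
      intro s hs
      rw [prod_Ico_succ_top (by simp at hs; omega)]
      ring
    rw [show 2 * (n + 1) = 2 * n + 1 + 1 by ring, sum_range_succ, sum_range_succ, h1, h2,
      sum_range_succ _ n]
    rw [show 2 * n + 1 + 1 = 2 * (n + 1) by ring, sum_congr rfl e, sum_add_distrib, key, ← mul_sum,
      ← ih, prod_range_succ]
    simp
    ring

theorem cp_shanks_phi_aux {A : Type*} [CommRing A] (q : A) (n : ℕ) (m : ℕ) (hm : m ≤ n) :
    ∑ s ∈ range m, (-1) ^ (s + 1) * (∏ i ∈ Ico (s + 1) n, (1 - q ^ (i + 1))) *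
      (∏ i ∈ range s, (1 + q ^ (i + 1))) *
      q ^ ((s + 1) * (n + 1)) * ((1 - q ^ (n + 1)) * q ^ (s + 1) - (1 + q ^ (n + 1)))
    = (-1) ^ (m + 1) * (∏ i ∈ Ico m n, (1 - q ^ (i + 1))) *
      (∏ i ∈ range m, (1 + q ^ (i + 1))) * q ^ ((m + 1) * (n + 1)) +
      (∏ i ∈ range n, (1 - q ^ (i + 1))) * q ^ (n + 1) := by
  induction m with
  | zero => simp
  | succ m ih =>
    rw [sum_range_succ, ih (by omega), prod_range_succ, prod_eq_prod_Ico_succ_bot (show m < n by omega)]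
    ring

theorem cp_shanks_phi {A : Type*} [CommRing A] (q : A) (n : ℕ) :
    (∏ i ∈ range n, (1 + q ^ (i + 1))) * (1 + 2 * ∑ s ∈ range n, (-1) ^ (s + 1) * q ^ ((s + 1) ^ 2)) =
    (∏ i ∈ range n, (1 - q ^ (i + 1))) + 2 * 
    ∑ s ∈ range n, (-1) ^ (s + 1) * (∏ i ∈ Ico (s + 1) n, (1 - q ^ (i + 1))) *
      (∏ i ∈ range s, (1 + q ^ (i + 1))) * q ^ ((s + 1) * (n + 1)) := by
  induction n with
  | zero => simp
  | succ n ih =>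
    have key := cp_shanks_phi_aux q n n le_rfl
    have e : ∀ s ∈ range n, (-1) ^ (s + 1) * (∏ i ∈ Ico (s + 1) (n + 1), (1 - q ^ (i + 1))) *
      (∏ i ∈ range s, (1 + q ^ (i + 1))) * q ^ ((s + 1) * (n + 1 + 1)) =
        (-1) ^ (s + 1) * (∏ i ∈ Ico (s + 1) n, (1 - q ^ (i + 1))) *
      (∏ i ∈ range s, (1 + q ^ (i + 1))) *
      q ^ ((s + 1) * (n + 1)) * ((1 - q ^ (n + 1)) * q ^ (s + 1) - (1 + q ^ (n + 1))) +
        (1 + q ^ (n + 1)) * ((-1) ^ (s + 1) * (∏ i ∈ Ico (s + 1) n, (1 - q ^ (i + 1))) *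
      (∏ i ∈ range s, (1 + q ^ (i + 1))) * q ^ ((s + 1) * (n + 1))) := by
      intro s hs
      rw [prod_Ico_succ_top (by simp at hs; omega)]
      ring
    rw [sum_range_succ, sum_range_succ _ n, sum_congr rfl e, sum_add_distrib, key, ← mul_sum,
      prod_range_succ, prod_range_succ (fun i => 1 - q ^ (i + 1))]
    simp only [Ico_self, prod_empty]
    linear_combination (1 + q ^ (n + 1)) * ih

/-- coefficients of the theta series `φ(-q)` -/
noncomputable def cpPhi (d : ℕ) : ℤ := ∑ y ∈ Icc (-(d : ℤ)) d, if y ^ 2 = (d : ℤ) then (-1) ^ y.natAbs else 0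

/-- coefficients of the theta series `ψ(q)` -/
def cpPsi (d : ℕ) : ℤ := ∑ s ∈ range (d + 1), if s * (s + 1) / 2 = d then 1 else 0

theorem cpPhi_ne_zero {d : ℕ} (h : cpPhi d ≠ 0) : ∃ y : ℤ, y ^ 2 = d := by
  obtain ⟨y, -, hy⟩ := exists_ne_zero_of_sum_ne_zero h
  exact ⟨y, by by_contra hc; simp [hc] at hy⟩

theorem cp_tri (s : ℕ) : 2 * (s * (s + 1) / 2) = s * (s + 1) :=
  Nat.mul_div_cancel' (Nat.even_mul_succ_self s).two_dvd

theorem cpPsi_ne_zero {d : ℕ} (h : cpPsi d ≠ 0) : ∃ x : ℤ, x ^ 2 = 8 * d + 1 := by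
  obtain ⟨s, -, hs⟩ := exists_ne_zero_of_sum_ne_zero h
  have hs' : s * (s + 1) / 2 = d := by by_contra hc; simp [hc] at hs
  refine ⟨2 * s + 1, ?_⟩
  have := cp_tri s
  rw [hs'] at this
  zify at this
  linarith

theorem cpPhi_eq (d n : ℕ) (h : d ≤ n) :
    cpPhi d = ∑ y ∈ Icc (-(n : ℤ)) n, if y ^ 2 = (d : ℤ) then (-1) ^ y.natAbs else 0 := by
  refine sum_subset (fun y hy => ?_) (fun y _ hy => ?_)
  · simp at hy ⊢; omega
  · rw [if_neg]
    rintro hc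
    apply hy
    simp only [mem_Icc]
    constructor <;> nlinarith

theorem cpPsi_eq (d n : ℕ) (h : d < n) :
    cpPsi d = ∑ s ∈ range n, if s * (s + 1) / 2 = d then 1 else 0 := by
  refine sum_subset (fun y hy => ?_) (fun y _ hy => ?_)
  · simp at hy ⊢; omega
  · rw [if_neg]
    rintro hc
    apply hy
    have := cp_tri y
    simp only [mem_range]
    rcases Nat.eq_zero_or_pos y with h0 | h0 <;> nlinarith

theorem cpPsi_two (d n : ℕ) (h : 8 * d + 1 ≤ n) :
    2 * cpPsi d = ∑ x ∈ Icc (-(n : ℤ)) n, if x ^ 2 = 8 * (d : ℤ) + 1 then 1 else 0 := by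
  by_cases hd : ∃ s : ℕ, s * (s + 1) / 2 = d
  · obtain ⟨s, hs⟩ := hd
    have h2 := cp_tri s
    have hs1 : s < d + 1 := by rcases Nat.eq_zero_or_pos s with h0 | h0 <;> nlinarith
    have e1 : cpPsi d = 1 := by
      unfold cpPsi
      rw [sum_eq_single s]
      · simp [hs]
      · intro t _ hts
        rw [if_neg]
        intro ht
        have h3 := cp_tri t
        rw [ht, ← hs, h2] at h3
        rcases lt_or_gt_of_ne hts with h | h <;> nlinarith
      · intro hn; simp at hn; omega
    rw [e1, ← sum_filter]
    have : (Icc (-(n : ℤ)) n).filter (fun x => x ^ 2 = 8 * (d : ℤ) + 1) = ({2 * (s : ℤ) + 1, -(2 * (s : ℤ) + 1)} : Finset ℤ) := by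
      ext x
      have hx : 8 * (d : ℤ) + 1 = (2 * s + 1) ^ 2 := by
        rw [hs] at h2; zify at h2; linarith
      simp only [mem_filter, mem_Icc, mem_insert, mem_singleton]
      rw [hx, sq_eq_sq_iff_eq_or_eq_neg]
      constructor
      · exact fun h => h.2
      · rintro (rfl | rfl) <;> constructor <;> omega
    rw [this, sum_pair (by omega)]
    norm_num
  · have e1 : cpPsi d = 0 := sum_eq_zero fun s _ => if_neg fun h => hd ⟨s, h⟩
    rw [e1, eq_comm, mul_zero]
    refine sum_eq_zero fun x _ => if_neg fun hx => hd ?_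
    have hodd : Odd x := by
      have : Odd (x ^ 2) := ⟨4 * d, by linarith⟩
      exact (Int.odd_pow.1 this).resolve_right (by norm_num)
    have : Odd x.natAbs := Int.natAbs_odd.2 hodd
    obtain ⟨s, hs⟩ := this
    refine ⟨s, ?_⟩
    have h2 := cp_tri s
    have : (x.natAbs : ℤ) ^ 2 = 8 * d + 1 := by rw [Int.natAbs_sq, hx]
    rw [hs] at this
    zify at h2 ⊢
    push_cast at this
    nlinarith

/-- representations by `x² + 8 y²` -/
noncomputable def cpRep (M : ℤ) : Finset (ℤ × ℤ) :=
  (Icc (-M) M ×ˢ Icc (-M) M).filter fun p => p.1 ^ 2 + 8 * p.2 ^ 2 = M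

theorem mem_cpRep {M : ℤ} {p : ℤ × ℤ} : p ∈ cpRep M ↔ p.1 ^ 2 + 8 * p.2 ^ 2 = M := by
  simp only [cpRep, mem_filter, mem_product, mem_Icc, and_iff_right_iff_imp]
  intro h
  refine ⟨⟨?_, ?_⟩, ?_, ?_⟩ <;> nlinarith [sq_nonneg p.1, sq_nonneg p.2]

/-- coefficients of `2 φ(-q) ψ(q)` -/
noncomputable def cpC (M : ℤ) : ℤ := ∑ p ∈ cpRep M, (-1) ^ p.2.natAbs

theorem cp_conv (m : ℕ) :
    2 * ∑ p ∈ antidiagonal m, cpPhi p.1 * cpPsi p.2 = cpC (8 * m + 1) := by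
  have h1 : ∀ p ∈ antidiagonal m, 2 * (cpPhi p.1 * cpPsi p.2) =
      ∑ q ∈ Icc (-(8 * m + 1 : ℤ)) (8 * m + 1) ×ˢ Icc (-(8 * m + 1 : ℤ)) (8 * m + 1),
        if q.2 ^ 2 = (p.1 : ℤ) ∧ q.1 ^ 2 = 8 * (p.2 : ℤ) + 1 then (-1) ^ q.2.natAbs else 0 := by
    intro p hp
    rw [HasAntidiagonal.mem_antidiagonal] at hp
    have a := cpPhi_eq p.1 (8 * m + 1) (by omega)
    have b := cpPsi_two p.2 (8 * m + 1) (by omega)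
    push_cast at a b
    rw [show 2 * (cpPhi p.1 * cpPsi p.2) = (2 * cpPsi p.2) * cpPhi p.1 by ring, a, b, sum_mul_sum,
      sum_product]
    refine sum_congr rfl fun x _ => sum_congr rfl fun y _ => ?_
    split_ifs <;> simp_all
  rw [mul_sum, sum_congr rfl h1, sum_comm, cpC, cpRep, sum_filter]
  refine sum_congr rfl fun q _ => ?_
  split_ifs with hq
  · have hle : q.2 ^ 2 ≤ m := by nlinarith [sq_nonneg q.1]
    rw [sum_eq_single ((q.2 ^ 2).toNat, m - (q.2 ^ 2).toNat)]
    · have : ((q.2 ^ 2).toNat : ℤ) = q.2 ^ 2 := Int.toNat_of_nonneg (sq_nonneg _)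
      rw [if_pos]
      refine ⟨this.symm, ?_⟩
      rw [Nat.cast_sub (by omega), this]
      linarith
    · intro p hp hne
      rw [if_neg]
      rintro ⟨ha, hb⟩
      apply hne
      rw [HasAntidiagonal.mem_antidiagonal] at hp
      ext <;> simp <;> omega
    · intro hn
      exfalso; apply hn
      rw [HasAntidiagonal.mem_antidiagonal]
      simp only
      omega
  · refine sum_eq_zero fun p hp => if_neg ?_
    rintro ⟨ha, hb⟩
    apply hq
    rw [HasAntidiagonal.mem_antidiagonal] at hp
    rw [ha, hb, ← hp]; push_cast; ring

theorem cp_npow {a b : ℤ} (h : Odd (a + b)) : (-1 : ℤ) ^ a.natAbs = -(-1) ^ b.natAbs := by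
  rcases Int.even_or_odd b with hb | hb
  · have ha : Odd a := by
      rcases Int.even_or_odd a with ha | ha
      · exact absurd h (by simpa using ha.add hb)
      · exact ha
    rw [(Int.natAbs_odd.2 ha).neg_one_pow, (Int.natAbs_even.2 hb).neg_one_pow]
  · have ha : Even a := by
      rcases Int.even_or_odd a with ha | ha
      · exact ha
      · exact absurd h (by simpa using ha.add_odd hb)
    rw [(Int.natAbs_odd.2 hb).neg_one_pow, (Int.natAbs_even.2 ha).neg_one_pow]; simp

theorem cp_rep_sum (n : ℤ) : cpC (24 * n + 9) =
    - ∑ p ∈ (cpRep (24 * n + 9)).filter (fun p => 3 ∣ p.1 + p.2 ∧ 3 ∣ p.1 - p.2),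
      (-1) ^ p.2.natAbs := by
  set S := cpRep (24 * n + 9) with hS
  have hAB : ∑ p ∈ S.filter (fun p => 3 ∣ p.1 + p.2), (-1 : ℤ) ^ p.2.natAbs =
      ∑ p ∈ S.filter (fun p => 3 ∣ p.1 - p.2), -(-1 : ℤ) ^ p.2.natAbs := by
    refine sum_bij' (fun p _ => ((-p.1 + 8 * p.2) / 3, (-p.1 - p.2) / 3))
      (fun p _ => ((-p.1 - 8 * p.2) / 3, (p.1 - p.2) / 3)) ?_ ?_ ?_ ?_ ?_
    · rintro ⟨x, y⟩ hp
      simp only [mem_filter, hS, mem_cpRep] at hp ⊢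
      obtain ⟨h, t, ht⟩ := hp
      obtain rfl : x = 3 * t - y := by linarith
      rw [show (-(3 * t - y) + 8 * y) / 3 = 3 * y - t by omega,
        show (-(3 * t - y) - y) / 3 = -t by omega]
      exact ⟨by linarith, y, by ring⟩
    · rintro ⟨x, y⟩ hp
      simp only [mem_filter, hS, mem_cpRep] at hp ⊢
      obtain ⟨h, t, ht⟩ := hp
      obtain rfl : x = 3 * t + y := by linarith
      rw [show (-(3 * t + y) - 8 * y) / 3 = -3 * y - t by omega,
        show (3 * t + y - y) / 3 = t by omega]
      exact ⟨by linarith, -y, by ring⟩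
    · rintro ⟨x, y⟩ hp
      simp only [mem_filter] at hp
      ext <;> simp only <;> omega
    · rintro ⟨x, y⟩ hp
      simp only [mem_filter] at hp
      ext <;> simp only <;> omega
    · rintro ⟨x, y⟩ hp
      simp only [mem_filter, hS, mem_cpRep] at hp ⊢
      have hx : Odd x := by
        have : Odd (x ^ 2) := ⟨12 * n + 4 - 4 * y ^ 2, by linarith⟩
        exact (Int.odd_pow.1 this).resolve_right (by norm_num)
      refine cp_npow ?_
      obtain ⟨u, rfl⟩ := hx
      obtain ⟨h, t, ht⟩ := hp
      rw [show (-(2 * u + 1) - y) / 3 = -t by omega, Int.odd_iff]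
      omega
  have h3 : ∀ p ∈ S, 3 ∣ p.1 + p.2 ∨ 3 ∣ p.1 - p.2 := by
    intro p hp
    rw [hS, mem_cpRep] at hp
    have : (3 : ℤ) ∣ (p.1 + p.2) * (p.1 - p.2) := ⟨8 * n + 3 - 3 * p.2 ^ 2, by linarith⟩
    exact (Int.prime_three).dvd_or_dvd this
  have hu : S.filter (fun p => 3 ∣ p.1 + p.2) ∪ S.filter (fun p => 3 ∣ p.1 - p.2) = S := by
    rw [← filter_or, filter_true_of_mem h3]
  have := sum_union_inter (s₁ := S.filter (fun p => 3 ∣ p.1 + p.2))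
    (s₂ := S.filter (fun p => 3 ∣ p.1 - p.2)) (f := fun p : ℤ × ℤ => (-1 : ℤ) ^ p.2.natAbs)
  rw [hu, ← filter_and, hAB, sum_neg_distrib] at this
  rw [cpC, ← hS]
  linarith

theorem cp_C_not_dvd (n : ℤ) (h : ¬ 3 ∣ n) : cpC (24 * n + 9) = 0 := by
  rw [cp_rep_sum, neg_eq_zero]
  refine sum_eq_zero fun p hp => absurd ?_ h
  simp only [mem_filter, mem_cpRep] at hp
  obtain ⟨h1, ⟨a, ha⟩, b, hb⟩ := hp
  obtain ⟨x, hx⟩ : (3 : ℤ) ∣ p.1 := by omega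
  obtain ⟨y, hy⟩ : (3 : ℤ) ∣ p.2 := by omega
  rw [hx, hy] at h1
  have : 8 * n + 3 = 3 * (x ^ 2 + 8 * y ^ 2) := by linarith
  omega

theorem cp_C_dvd (n : ℤ) : cpC (24 * (3 * n) + 9) = - cpC (8 * n + 1) := by
  rw [cp_rep_sum, cpC]
  congr 1
  refine sum_bij' (fun p _ => (p.1 / 3, p.2 / 3)) (fun p _ => (3 * p.1, 3 * p.2)) ?_ ?_ ?_ ?_ ?_
  · rintro ⟨x, y⟩ hp
    simp only [mem_filter, mem_cpRep] at hp ⊢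
    obtain ⟨h1, ha, hb⟩ := hp
    obtain ⟨x, rfl⟩ : (3 : ℤ) ∣ x := by omega
    obtain ⟨y, rfl⟩ : (3 : ℤ) ∣ y := by omega
    simp only [ne_eq, OfNat.ofNat_ne_zero, not_false_eq_true, Int.mul_ediv_cancel_left]
    linarith
  · rintro ⟨x, y⟩ hp
    simp only [mem_filter, mem_cpRep] at hp ⊢
    exact ⟨by linarith, by omega, by omega⟩
  · rintro ⟨x, y⟩ hp
    simp only [mem_filter] at hp
    ext <;> simp only <;> omega
  · rintro ⟨x, y⟩ hp
    simp
  · rintro ⟨x, y⟩ hp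
    simp only [mem_filter] at hp
    obtain ⟨y, rfl⟩ : (3 : ℤ) ∣ y := by omega
    simp [Int.natAbs_mul, pow_mul]

theorem cp_three_dvd {y z : ℤ} (h : 3 ∣ y ^ 2 + z ^ 2) : 3 ∣ y ∧ 3 ∣ z := by
  have hy : y % 3 = 0 ∨ y % 3 = 1 ∨ y % 3 = 2 := by omega
  have hz : z % 3 = 0 ∨ z % 3 = 1 ∨ z % 3 = 2 := by omega
  rw [Int.dvd_iff_emod_eq_zero] at h
  rw [Int.dvd_iff_emod_eq_zero, Int.dvd_iff_emod_eq_zero]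
  rcases hy with hy | hy | hy <;> rcases hz with hz | hz | hz <;>
    simp [pow_two, Int.add_emod, Int.mul_emod, hy, hz] at h
  exact ⟨hy, hz⟩

theorem cp_descent (k : ℕ) : ∀ (x y z n : ℤ), x ^ 2 + 24 * (y ^ 2 + z ^ 2) ≠ 9 ^ k * (24 * n + 17) := by
  induction k with
  | zero =>
    intro x y z n h
    have hx : x % 3 = 0 ∨ x % 3 = 1 ∨ x % 3 = 2 := by omega
    have h2 : x ^ 2 % 3 = 2 := by omega
    rcases hx with hx | hx | hx <;> simp [pow_two, Int.mul_emod, hx] at h2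
  | succ k ih =>
    intro x y z n h
    have hx : (3 : ℤ) ∣ x := Int.prime_three.dvd_of_dvd_pow (n := 2)
      ⟨3 * 9 ^ k * (24 * n + 17) - 8 * (y ^ 2 + z ^ 2), by rw [pow_succ (9 : ℤ)] at h; linarith⟩
    obtain ⟨x, rfl⟩ := hx
    have h3 : (3 : ℤ) ∣ y ^ 2 + z ^ 2 := by
      rw [pow_succ (9 : ℤ)] at h
      have : 9 ^ k * 9 * (24 * n + 17) = 9 * (9 ^ k * (24 * n + 17)) := by ring
      have : 3 * x ^ 2 + 8 * (y ^ 2 + z ^ 2) = 3 * (9 ^ k * (24 * n + 17)) := by linarith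
      generalize (9 : ℤ) ^ k * (24 * n + 17) = w at *
      omega
    obtain ⟨⟨y, rfl⟩, z, rfl⟩ := cp_three_dvd h3
    refine ih x y z n ?_
    rw [pow_succ (9 : ℤ)] at h
    linarith

theorem cp_final (k : ℕ) (n N : ℤ) (hN : 8 * N + 3 = 3 * (9 ^ k * (24 * n + 17))) (x y z t : ℤ)
    (hx : x ^ 2 = 8 * t + 1) : y ^ 2 + z ^ 2 + 3 * t ≠ N := by
  rintro rfl
  have h3 : (3 : ℤ) ∣ y ^ 2 + z ^ 2 := by
    generalize (9 : ℤ) ^ k * (24 * n + 17) = w at *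
    omega
  obtain ⟨⟨y, rfl⟩, z, rfl⟩ := cp_three_dvd h3
  exact cp_descent k x y z n (by linarith)

open PowerSeries PowerSeries.WithPiTopology Filter Topology

section
variable (R : Type*) [CommRing R]

/-- `φ(-q)` -/
noncomputable def cpPhiS : R⟦X⟧ := PowerSeries.mk fun d => (cpPhi d : R)
/-- `ψ(q)` -/
noncomputable def cpPsiS : R⟦X⟧ := PowerSeries.mk fun d => (cpPsi d : R)
/-- all partitions -/
noncomputable def cpP : R⟦X⟧ :=
  PowerSeries.mk fun n => (#(Nat.Partition.restricted n (fun _ => True)) : R)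
/-- partitions into odd parts -/
noncomputable def cpO : R⟦X⟧ :=
  PowerSeries.mk fun n => (#(Nat.Partition.restricted n (¬ Even ·)) : R)

theorem cp_coeff_of_dvd {f : R⟦X⟧} {N d : ℕ} (h : (X : R⟦X⟧) ^ N ∣ f) (hd : d < N) :
    coeff d f = 0 := PowerSeries.X_pow_dvd_iff.1 h d hd

theorem cp_phi_partial (n : ℕ) :
    (1 + 2 * ∑ s ∈ range n, (-1) ^ (s + 1) * (X : R⟦X⟧) ^ ((s + 1) ^ 2)) =
    ∑ y ∈ Icc (-(n : ℤ)) n, (-1) ^ y.natAbs * X ^ (y.natAbs ^ 2) := by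
  induction n with
  | zero => simp
  | succ n ih =>
    have : Icc (-((n + 1 : ℕ) : ℤ)) (n + 1 : ℕ) =
        insert (-((n : ℤ) + 1)) (insert ((n : ℤ) + 1) (Icc (-(n : ℤ)) n)) := by
      ext y; simp only [mem_Icc, mem_insert]; push_cast; omega
    rw [this, sum_insert (by simp; omega), sum_insert (by simp), ← ih, sum_range_succ]
    have e1 : (-((n : ℤ) + 1)).natAbs = n + 1 := by omega
    have e2 : ((n : ℤ) + 1).natAbs = n + 1 := by omega
    rw [e1, e2]
    ring

theorem cp_coeff_phi_partial (n d : ℕ) (h : d ≤ n) :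
    coeff d (1 + 2 * ∑ s ∈ range n, (-1) ^ (s + 1) * (X : R⟦X⟧) ^ ((s + 1) ^ 2)) =
      coeff d (cpPhiS R) := by
  rw [cp_phi_partial, cpPhiS, coeff_mk, cpPhi_eq d n h, map_sum, Int.cast_sum]
  refine sum_congr rfl fun y _ => ?_
  have : ((-1 : R⟦X⟧) ^ y.natAbs) = C ((-1 : R) ^ y.natAbs) := by simp
  rw [this, coeff_C_mul, coeff_X_pow]
  have h2 : y ^ 2 = (d : ℤ) ↔ d = y.natAbs ^ 2 := by
    zify; rw [sq_abs]; exact eq_comm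
  simp only [h2]
  split_ifs <;> simp

theorem cp_coeff_psi_partial (n d : ℕ) (h : d < n) :
    coeff d (∑ s ∈ range n, (X : R⟦X⟧) ^ (s * (s + 1) / 2)) = coeff d (cpPsiS R) := by
  rw [cpPsiS, coeff_mk, cpPsi_eq d n h, map_sum, Int.cast_sum]
  refine sum_congr rfl fun y _ => ?_
  rw [coeff_X_pow]
  simp only [eq_comm (a := d)]
  split_ifs <;> simp

variable [TopologicalSpace R] [IsTopologicalRing R] [T2Space R]

theorem cp_tendsto_of_coeff (g : ℕ → R⟦X⟧) (f : R⟦X⟧)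
    (h : ∀ d, ∀ n, d < n → coeff d (g n) = coeff d f) : Tendsto g atTop (𝓝 f) := by
  rw [tendsto_iff_coeff_tendsto]
  exact fun d => tendsto_atTop_of_eventually_const (i₀ := d + 1) fun n hn => h d n hn

theorem cp_tendsto_zero (g : ℕ → R⟦X⟧) (h : ∀ n, X ^ n ∣ g n) : Tendsto g atTop (𝓝 0) :=
  cp_tendsto_of_coeff R g 0 fun d n hd => by rw [cp_coeff_of_dvd R (h n) hd, map_zero]

theorem cp_hasProd_O : HasProd (fun i : ℕ => 1 + (X : R⟦X⟧) ^ (i + 1)) (cpO R) := by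
  have := Nat.Partition.hasProd_powerSeriesMk_card_countRestricted R (m := 2) (by norm_num)
  have e1 : cpO R = PowerSeries.mk fun n => (#(Nat.Partition.countRestricted n 2) : R) := by
    rw [cpO]
    congr 1
    funext n
    rw [Nat.Partition.countRestricted_two, ← Nat.Partition.card_odds_eq_card_distincts]
    rfl
  have e2 : (fun i : ℕ => 1 + (X : R⟦X⟧) ^ (i + 1)) =
      fun i => ∑ j ∈ range 2, (X : R⟦X⟧) ^ ((i + 1) * j) := by
    funext i
    simp [sum_range_succ]
  rw [e1, e2]
  exact this

theorem cp_tendsto_E : Tendsto (fun n => ∏ i ∈ range n, (1 - (X : R⟦X⟧) ^ (i + 1))) atTop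
    (𝓝 (∏' i, (1 - (X : R⟦X⟧) ^ (i + 1)))) :=
  (multipliable_one_sub_X_pow R).hasProd.tendsto_prod_nat

theorem cp_P_mul : cpP R * ∏' i, (1 - (X : R⟦X⟧) ^ (i + 1)) = 1 := by
  have h1 := Nat.Partition.hasProd_powerSeriesMk_card_restricted R (fun _ => True)
  have h2 := h1.mul (multipliable_one_sub_X_pow R).hasProd
  refine h2.unique ?_
  convert hasProd_one with i
  simp only [if_true, pow_mul]
  exact tsum_pow_mul_one_sub_of_constantCoeff_eq_zero (by simp)

theorem cp_phi : cpO R * cpPhiS R = ∏' i, (1 - (X : R⟦X⟧) ^ (i + 1)) := by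
  have h1 := (cp_hasProd_O R).tendsto_prod_nat.mul (cp_tendsto_of_coeff R _ (cpPhiS R)
    fun d n hd => cp_coeff_phi_partial R n d hd.le)
  simp only [cp_shanks_phi] at h1
  have h2 := (cp_tendsto_E R).add (cp_tendsto_zero R (fun n => 2 *
    ∑ s ∈ range n, (-1) ^ (s + 1) * (∏ i ∈ Ico (s + 1) n, (1 - (X : R⟦X⟧) ^ (i + 1))) *
      (∏ i ∈ range s, (1 + X ^ (i + 1))) * X ^ ((s + 1) * (n + 1))) (fun n => by
      refine Dvd.dvd.mul_left (dvd_sum fun s _ => Dvd.dvd.mul_left (pow_dvd_pow _ ?_) _) _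
      nlinarith))
  rw [add_zero] at h2
  exact tendsto_nhds_unique h1 h2

theorem cp_psi : cpPsiS R = cpO R * ((∏' i, (1 - (X : R⟦X⟧) ^ (i + 1))) * cpO R) := by
  have hO := (Nat.Partition.hasProd_powerSeriesMk_card_restricted R (¬ Even ·)).tendsto_prod_nat
  have hO2 := hO.comp (tendsto_id.const_mul_atTop' (show 0 < 2 by norm_num))
  set A : ℕ → R⟦X⟧ := fun n => ∏ i ∈ range (2 * n),
    if ¬ Even (i + 1) then ∑' j : ℕ, (X : R⟦X⟧) ^ ((i + 1) * j) else 1 with hA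
  have hA1 : ∀ n, A n * ∏ i ∈ range n, (1 - (X : R⟦X⟧) ^ (2 * i + 1)) = 1 := by
    intro n
    induction n with
    | zero => simp [hA]
    | succ n ih =>
      have : A (n + 1) = A n * ∑' j : ℕ, (X : R⟦X⟧) ^ ((2 * n + 1) * j) := by
        simp only [hA]
        rw [show 2 * (n + 1) = 2 * n + 1 + 1 by ring, prod_range_succ, prod_range_succ,
          if_pos (by simp), if_neg (by simp [Nat.even_add_one])]
        ring
      have h2 : (∑' j : ℕ, (X : R⟦X⟧) ^ ((2 * n + 1) * j)) * (1 - X ^ (2 * n + 1)) = 1 := by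
        simp only [pow_mul _ (2 * n + 1)]
        exact tsum_pow_mul_one_sub_of_constantCoeff_eq_zero (by simp)
      rw [this, prod_range_succ]
      linear_combination (∑' j : ℕ, (X : R⟦X⟧) ^ ((2 * n + 1) * j)) * (1 - X ^ (2 * n + 1)) * ih + h2
  have hAt : Tendsto A atTop (𝓝 (cpO R)) := hO2
  have hE := (cp_tendsto_E R).mul (cp_hasProd_O R).tendsto_prod_nat
  have hr : Tendsto (fun n => A n * (∑ s ∈ Ico 1 n, (∏ i ∈ Ico s n, (1 - (X : R⟦X⟧) ^ (2 * i + 2))) *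
      (∏ i ∈ range s, (1 - X ^ (2 * i + 1))) * X ^ (s * (2 * n + 1)))) atTop (𝓝 0) := by
    refine cp_tendsto_zero R _ fun n => Dvd.dvd.mul_left (dvd_sum fun s hs =>
      Dvd.dvd.mul_left (pow_dvd_pow _ ?_) _) _
    have := (mem_Ico.1 hs).1
    nlinarith
  have hS := cp_tendsto_of_coeff R (fun n => ∑ s ∈ range (2 * n), (X : R⟦X⟧) ^ (s * (s + 1) / 2))
    (cpPsiS R) fun d n hd => cp_coeff_psi_partial R (2 * n) d (by omega)
  have hT := (hAt.mul hE).add hr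
  rw [add_zero] at hT
  refine tendsto_nhds_unique hS (hT.congr' ?_)
  filter_upwards [eventually_ge_atTop 1] with n hn
  have h3 := cp_shanks_psi (X : R⟦X⟧) n
  rw [range_eq_Ico n, sum_eq_sum_Ico_succ_bot (by omega)] at h3
  simp only [range_zero, prod_empty, zero_mul, pow_zero, mul_one, zero_add] at h3
  simp only [← range_eq_Ico] at h3
  have h4 : ∏ i ∈ range n, (1 - (X : R⟦X⟧) ^ (2 * i + 2)) =
      (∏ i ∈ range n, (1 - (X : R⟦X⟧) ^ (i + 1))) * ∏ i ∈ range n, (1 + (X : R⟦X⟧) ^ (i + 1)) := by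
    rw [← prod_mul_distrib]
    refine prod_congr rfl fun i _ => ?_
    ring
  rw [← h4, ← mul_add, ← h3, ← mul_assoc, hA1, one_mul]

theorem cp_main_id : cpP R * cpO R ^ 4 * cpPhiS R ^ 2 = cpPsiS R := by
  have h1 := cp_P_mul R
  have h2 := cp_phi R
  have h3 := cp_psi R
  rw [h3]
  rw [← h2] at h1 ⊢
  linear_combination (cpO R ^ 3 * cpPhiS R) * h1

end

theorem cp_card (p : Fin 5 → ℕ → Prop) [∀ i, DecidablePred (p i)] (n : ℕ) :
    Set.ncard {c : Fin 5 → Multiset ℕ |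
      (∀ i, ∀ x ∈ c i, 0 < x) ∧ (∀ i, ∀ x ∈ c i, p i x) ∧ (∑ i, (c i).sum) = n} =
    ∑ l ∈ finsuppAntidiag (univ : Finset (Fin 5)) n,
      ∏ i, #(Nat.Partition.restricted (l i) (p i)) := by
  classical
  have : {c : Fin 5 → Multiset ℕ |
      (∀ i, ∀ x ∈ c i, 0 < x) ∧ (∀ i, ∀ x ∈ c i, p i x) ∧ (∑ i, (c i).sum) = n} =
      ((finsuppAntidiag (univ : Finset (Fin 5)) n).biUnion fun l => Fintype.piFinset fun i =>
        (Nat.Partition.restricted (l i) (p i)).image Nat.Partition.parts : Finset _) := by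
    ext c
    simp only [Set.mem_ofPred_eq, coe_biUnion, Set.mem_iUnion, mem_coe, mem_finsuppAntidiag,
      Fintype.mem_piFinset, mem_image, Nat.Partition.restricted, mem_filter, mem_univ, true_and]
    constructor
    · rintro ⟨h1, h2, h3⟩
      refine ⟨Finsupp.equivFunOnFinite.symm fun i => (c i).sum, ⟨by simpa using h3, by simp⟩, ?_⟩
      intro i
      exact ⟨⟨c i, fun {x} hx => h1 i x hx, rfl⟩, h2 i, rfl⟩
    · rintro ⟨l, ⟨hl, -⟩, h⟩
      choose q hq hc using h
      refine ⟨fun i x hx => ?_, fun i x hx => ?_, ?_⟩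
      · rw [← hc] at hx; exact (q i).parts_pos hx
      · rw [← hc] at hx; exact hq i x hx
      · rw [← hl]
        refine sum_congr rfl fun i _ => ?_
        rw [← hc]; exact (q i).parts_sum
  rw [this, Set.ncard_coe_finset, card_biUnion]
  · refine sum_congr rfl fun l _ => ?_
    rw [Fintype.card_piFinset]
    refine prod_congr rfl fun i _ => ?_
    exact card_image_of_injective _ fun a b h => Nat.Partition.ext h
  · intro l _ l' _ hne
    rw [Function.onFun, disjoint_left]
    intro c h h'
    apply hne
    ext i
    simp only [Fintype.mem_piFinset, mem_image] at h h'
    obtain ⟨a, -, ha⟩ := h i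
    obtain ⟨b, -, hb⟩ := h' i
    rw [← a.parts_sum, ← b.parts_sum, ha, hb]

theorem cp_genfun (R : Type*) [CommRing R] (n : ℕ) :
    (coloredPartition 5 n : R) = coeff n (cpP R * cpO R ^ 4) := by
  classical
  have h0 := cp_card (fun i x => i.val = 0 ∨ ¬ Even x) n
  have h1 : coloredPartition 5 n = ∑ l ∈ finsuppAntidiag (univ : Finset (Fin 5)) n,
      ∏ i, #(Nat.Partition.restricted (l i) (fun x => i.val = 0 ∨ ¬ Even x)) := by
    unfold coloredPartition
    refine Eq.trans ?_ h0
    congr 1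
    ext c
    simp only [Set.mem_ofPred_eq, Nat.not_even_iff_odd]
    refine and_congr_right fun _ => and_congr_left fun _ => forall_congr' fun i => ?_
    by_cases hi : i.val = 0 <;> simp [hi]
  have h2 : cpP R * cpO R ^ 4 = ∏ i : Fin 5, PowerSeries.mk fun n =>
      (#(Nat.Partition.restricted n (fun x => i.val = 0 ∨ ¬ Even x)) : R) := by
    rw [Fin.prod_univ_succ]
    simp [cpP, cpO]
  rw [h1, h2, coeff_prod]
  push_cast
  simp

/-- Frobenius on power series. -/
theorem cp_frob (f : (ZMod 3)⟦X⟧) : f ^ 3 = expand 3 (by norm_num) f := by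
  have h := MvPowerSeries.map_frobenius_expand (σ := Unit) (R := ZMod 3) 3 (by norm_num) (f := f)
  rw [← h, ZMod.frobenius_zmod, MvPowerSeries.map_id]
  rfl

theorem cp_coeff_phi_psi (m : ℕ) :
    coeff m (cpPhiS (ZMod 3) * cpPsiS (ZMod 3)) = - (cpC (8 * m + 1) : ZMod 3) := by
  rw [← cp_conv, coeff_mul]
  simp only [cpPhiS, cpPsiS, coeff_mk]
  push_cast
  have h3 : (3 : ZMod 3) = 0 := rfl
  linear_combination (∑ p ∈ antidiagonal m, (cpPhi p.1 : ZMod 3) * (cpPsi p.2 : ZMod 3)) * h3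

theorem cp_coeff_phi_psi_three (n : ℕ) :
    coeff (3 * n + 1) (cpPhiS (ZMod 3) * cpPsiS (ZMod 3)) =
    - coeff n (expand 3 (by norm_num) (cpPhiS (ZMod 3) * cpPsiS (ZMod 3))) := by
  rw [cp_coeff_phi_psi, coeff_expand]
  have e : (8 * ((3 * n + 1 : ℕ) : ℤ) + 1) = 24 * n + 9 := by push_cast; ring
  rw [e]
  split_ifs with h
  · obtain ⟨m, rfl⟩ := h
    rw [Nat.mul_div_cancel_left _ (by norm_num), cp_coeff_phi_psi]
    have := cp_C_dvd m
    push_cast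
    rw [this]
    push_cast
    ring
  · rw [cp_C_not_dvd n (by exact_mod_cast h)]
    simp

theorem cp_dissect (F f : (ZMod 3)⟦X⟧) (n : ℕ) :
    coeff (3 * n + 1) (F * expand 3 (by norm_num) f) =
    coeff n ((PowerSeries.mk fun i => coeff (3 * i + 1) F) * f) := by
  rw [coeff_mul, coeff_mul]
  symm
  refine sum_of_injOn (fun p => (3 * p.1 + 1, 3 * p.2)) ?_ ?_ ?_ ?_
  · rintro ⟨a, b⟩ _ ⟨c, d⟩ _ h
    simp only [Prod.mk.injEq] at h
    ext <;> simp only <;> omega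
  · rintro ⟨a, b⟩ h
    simp only [mem_coe, HasAntidiagonal.mem_antidiagonal] at h ⊢
    omega
  · rintro ⟨a, b⟩ h h2
    rw [coeff_expand, if_neg, mul_zero]
    rintro ⟨c, rfl⟩
    apply h2
    simp only [HasAntidiagonal.mem_antidiagonal] at h
    refine ⟨(n - c, c), ?_, ?_⟩
    · simp only [mem_coe, HasAntidiagonal.mem_antidiagonal]; omega
    · ext <;> simp only; omega
  · rintro ⟨a, b⟩ _
    simp

theorem cp_F1 (n : ℕ) : (coloredPartition 5 (3 * n + 1) : ZMod 3) =
    - coeff n (cpPhiS (ZMod 3) ^ 2 * expand 3 (by norm_num) (cpPsiS (ZMod 3))) := by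
  have hF : cpP (ZMod 3) * cpO (ZMod 3) ^ 4 * cpPhiS (ZMod 3) ^ 2 = cpPsiS (ZMod 3) := by
    let : TopologicalSpace (ZMod 3) := ⊥
    have : DiscreteTopology (ZMod 3) := ⟨rfl⟩
    exact cp_main_id (ZMod 3)
  rw [cp_genfun]
  set F := cpP (ZMod 3) * cpO (ZMod 3) ^ 4 with hFdef
  set f := cpPhiS (ZMod 3) with hf
  set g := cpPsiS (ZMod 3) with hg
  have h1 : F * expand 3 (by norm_num) f = f * g := by
    rw [← cp_frob, ← hF]; ring
  have h2 : (PowerSeries.mk fun i => coeff (3 * i + 1) F) * f =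
      (- (f ^ 2 * expand 3 (by norm_num) g)) * f := by
    ext m
    rw [← cp_dissect, h1, cp_coeff_phi_psi_three, map_mul, ← cp_frob f, ← hg, ← map_neg]
    congr 1
    ring
  have hf0 : f ≠ 0 := by
    intro h
    have : coeff 0 f = 0 := by rw [h, map_zero]
    rw [hf, cpPhiS, coeff_mk] at this
    simp [cpPhi] at this
  have h3 := mul_right_cancel₀ hf0 h2
  have h4 := congrArg (coeff n) h3
  rwa [coeff_mk, map_neg] at h4

theorem cp_coeff_zero (k : ℕ) (n : ℤ) (N : ℕ)
    (hN : 8 * (N : ℤ) + 3 = 3 * (9 ^ k * (24 * n + 17))) :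
    coeff N (cpPhiS (ZMod 3) ^ 2 * expand 3 (by norm_num) (cpPsiS (ZMod 3))) = 0 := by
  by_contra hne
  rw [coeff_mul] at hne
  obtain ⟨⟨a, b⟩, hab, h⟩ := exists_ne_zero_of_sum_ne_zero hne
  simp only [HasAntidiagonal.mem_antidiagonal] at hab h
  have hb := right_ne_zero_of_mul h
  have ha := left_ne_zero_of_mul h
  rw [coeff_expand] at hb
  rw [pow_two, coeff_mul] at ha
  obtain ⟨⟨c, d⟩, hcd, h'⟩ := exists_ne_zero_of_sum_ne_zero ha
  simp only [HasAntidiagonal.mem_antidiagonal] at hcd h'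
  have hc := left_ne_zero_of_mul h'
  have hd := right_ne_zero_of_mul h'
  simp only [cpPhiS, cpPsiS, coeff_mk] at hb hc hd
  split_ifs at hb with h3
  · obtain ⟨t, rfl⟩ := h3
    rw [Nat.mul_div_cancel_left _ (by norm_num)] at hb
    obtain ⟨x, hx⟩ := cpPsi_ne_zero (d := t) (fun h0 => hb (by rw [h0]; simp))
    obtain ⟨y, hy⟩ := cpPhi_ne_zero (d := c) (fun h0 => hc (by rw [h0]; simp))
    obtain ⟨z, hz⟩ := cpPhi_ne_zero (d := d) (fun h0 => hd (by rw [h0]; simp))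
    refine cp_final k n N hN x y z t hx ?_
    rw [hy, hz]
    exact_mod_cast (by omega : c + d + 3 * t = N)
  · exact hb rfl

/-- For all `n, k ≥ 0`, `a_5(3^(2k+3) n + (153·3^(2k) − 1)/8) ≡ 0 (mod 3)`. -/
theorem coloredPartition_five_congr (n k : ℕ) :
    3 ∣ coloredPartition 5 (3 ^ (2 * k + 3) * n + (153 * 3 ^ (2 * k) - 1) / 8) := by
  have e1 : 3 ^ (2 * k) = 9 ^ k := by rw [pow_mul]; norm_num
  have e2 : 9 ^ k % 8 = 1 := by rw [Nat.pow_mod]; norm_num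
  obtain ⟨t, ht⟩ : ∃ t, 9 ^ k = 8 * t + 1 := ⟨9 ^ k / 8, by omega⟩
  have e3 : 3 ^ (2 * k + 3) * n + (153 * 3 ^ (2 * k) - 1) / 8 =
      3 * (9 * (8 * t + 1) * n + 51 * t + 6) + 1 := by
    rw [pow_add, e1, ht, show 153 * (8 * t + 1) - 1 = 8 * (153 * t + 19) by omega,
      Nat.mul_div_cancel_left _ (by norm_num)]
    ring
  rw [e3, ← CharP.cast_eq_zero_iff (ZMod 3) 3, cp_F1, neg_eq_zero]
  refine cp_coeff_zero k n _ ?_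
  have : (9 : ℤ) ^ k = 8 * t + 1 := by exact_mod_cast ht
  rw [this]
  push_cast
  ring
end

section
/- Fix an integer α ≥ 0 and write α = 9j + t with integers j ≥ 0 and 0 ≤ t ≤ 8. Suppose that for all n ≥ 0 one has a_{3α+2}(27n + 18 + t) ≡ 0 (mod 3), and that for all n ≥ 0 one has a_{3α+2}(9n + t) ≡ a_{3α+2}(81n + 10t + 9j) (mod 3). Then for all integers n ≥ 0 and k ≥ 0, a_{3α+2}(3^{2k+3} n + δ_k) ≡ 0 (mod 3), where δ_k = 9^k(18 + t) + α(9^k − 1)/8. -/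
/-- If the base congruence and the internal congruence hold for `α = 9j + t`, then the
whole infinite family of congruences mod 3 holds. -/
theorem coloredPartition_family_of_base_and_internal (α j t : ℕ)
    (hjt : α = 9 * j + t) (ht : t ≤ 8)
    (hbase : ∀ n : ℕ, 3 ∣ coloredPartition (3 * α + 2) (27 * n + 18 + t))
    (hinternal : ∀ n : ℕ, coloredPartition (3 * α + 2) (9 * n + t) ≡
      coloredPartition (3 * α + 2) (81 * n + 10 * t + 9 * j) [MOD 3]) :
    ∀ n k : ℕ, 3 ∣ coloredPartition (3 * α + 2)
      (3 ^ (2 * k + 3) * n + 9 ^ k * (18 + t) + α * (9 ^ k - 1) / 8) := by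
  intro n k
  have hR : ∀ k : ℕ, ∃ r : ℕ, 9 ^ k = 8 * r + 1 := by
    intro k
    induction k with
    | zero => exact ⟨0, rfl⟩
    | succ k ih =>
      obtain ⟨r, hr⟩ := ih
      exact ⟨9 * r + 1, by rw [pow_succ, hr]; ring⟩
  have hdiv : ∀ r : ℕ, α * (8 * r + 1 - 1) / 8 = α * r := by
    intro r
    rw [Nat.add_sub_cancel, show α * (8 * r) = 8 * (α * r) by ring]
    exact Nat.mul_div_cancel_left _ (by norm_num)
  have h3 : ∀ k : ℕ, 3 ^ (2 * k + 3) = 27 * 9 ^ k := by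
    intro k
    rw [pow_add, pow_mul]; norm_num; ring
  have key : ∃ m : ℕ, 3 ^ (2 * k + 3) * n + 9 ^ k * (18 + t) + α * (9 ^ k - 1) / 8 = 9 * m + t ∧
      3 ∣ coloredPartition (3 * α + 2) (9 * m + t) := by
    induction k with
    | zero =>
      refine ⟨3 * n + 2, by simp; ring, ?_⟩
      have := hbase n
      rwa [show 27 * n + 18 + t = 9 * (3 * n + 2) + t by ring] at this
    | succ k ih =>
      obtain ⟨m, hm, hd⟩ := ih
      obtain ⟨r, hr⟩ := hR k
      have hr' : 9 ^ (k + 1) = 8 * (9 * r + 1) + 1 := by rw [pow_succ, hr]; ring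
      rw [h3, hr, hdiv] at hm
      refine ⟨9 * m + t + j, ?_, ?_⟩
      · rw [h3, hr', hdiv]
        have : α * (9 * r + 1) = 9 * (α * r) + α := by ring
        rw [this]
        linarith
      · have h := hinternal m
        rw [show 81 * m + 10 * t + 9 * j = 9 * (9 * m + t + j) + t by ring] at h
        exact (h.dvd_iff (dvd_refl 3)).1 hd
  obtain ⟨m, hm, hd⟩ := key
  rw [hm]
  exact hd
end

section
/- For all integers n ≥ 0, the number a_{11}(5n + 4) is divisible by 5. -/
namespace ColoredAux
open PowerSeries

/-- Gaussian binomial coefficients, by the `q`-Pascal recursion. -/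
def gaussBin {R : Type*} [CommRing R] (q : R) : ℕ → ℕ → R
  | _, 0 => 1
  | 0, _ + 1 => 0
  | n + 1, k + 1 => gaussBin q n k + q ^ (k + 1) * gaussBin q n (k + 1)

/-- The finite product `(q; q)_n`. -/
def qPoch {R : Type*} [CommRing R] (q : R) (n : ℕ) : R :=
  ∏ i ∈ Finset.range n, (1 - q ^ (i + 1))

section General
variable {R : Type*} [CommRing R] (q : R)

theorem gaussBin_zero_right (n : ℕ) : gaussBin q n 0 = 1 := by
  cases n <;> rfl

theorem gaussBin_succ_succ (n k : ℕ) :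
    gaussBin q (n + 1) (k + 1) = gaussBin q n k + q ^ (k + 1) * gaussBin q n (k + 1) := rfl

theorem gaussBin_of_lt : ∀ (n k : ℕ), n < k → gaussBin q n k = 0
  | 0, k + 1, _ => rfl
  | n + 1, k + 1, h => by
    rw [gaussBin_succ_succ, gaussBin_of_lt n k (by omega), gaussBin_of_lt n (k + 1) (by omega)]
    simp

theorem qPoch_succ (n : ℕ) : qPoch q (n + 1) = qPoch q n * (1 - q ^ (n + 1)) := by
  simp [qPoch, Finset.prod_range_succ]

theorem gaussBin_mul (N : ℕ) : ∀ k m : ℕ, k + m = N →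
    gaussBin q N k * qPoch q k * qPoch q m = qPoch q N := by
  induction N with
  | zero =>
    intro k m h
    obtain ⟨rfl, rfl⟩ : k = 0 ∧ m = 0 := by omega
    simp [gaussBin_zero_right, qPoch]
  | succ N ih =>
    intro k m h
    cases k with
    | zero =>
      obtain rfl : m = N + 1 := by omega
      simp [gaussBin_zero_right, qPoch]
    | succ k =>
      have h1 := ih k m (by omega)
      rw [gaussBin_succ_succ, qPoch_succ q k, qPoch_succ q N]
      cases m with
      | zero =>
        obtain rfl : k = N := by omega
        rw [gaussBin_of_lt q k (k + 1) (by omega)]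
        linear_combination (1 - q ^ (k + 1)) * h1
      | succ m =>
        have h2 := ih (k + 1) m (by omega)
        rw [qPoch_succ q k] at h2
        rw [qPoch_succ q m] at h1 ⊢
        obtain rfl : N = k + m + 1 := by omega
        linear_combination (1 - q ^ (k + 1)) * h1 + q ^ (k + 1) * (1 - q ^ (m + 1)) * h2

theorem cauchy_binomial (N : ℕ) : ∀ x y : R,
    ∏ j ∈ Finset.range N, (y + x * q ^ j) =
      ∑ k ∈ Finset.range (N + 1), q ^ (k.choose 2) * gaussBin q N k * x ^ k * y ^ (N - k) := by
  induction N with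
  | zero => intro x y; simp [gaussBin_zero_right]
  | succ N ih =>
    intro x y
    rw [Finset.prod_range_succ']
    have h : ∀ j, y + x * q ^ (j + 1) = y + (x * q) * q ^ j := fun j => by ring
    simp only [h]
    rw [ih (x * q) y, Finset.sum_range_succ' _ (N + 1)]
    simp only [gaussBin_succ_succ, gaussBin_zero_right]
    have h3 : ∀ k, (k + 1).choose 2 = k + k.choose 2 := fun k => by
      rw [Nat.choose_succ_succ' k 1, Nat.choose_one_right]
    have e1 : ∑ k ∈ Finset.range (N + 1), q ^ ((k + 1).choose 2) *
          (gaussBin q N k + q ^ (k + 1) * gaussBin q N (k + 1)) * x ^ (k + 1) *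
          y ^ (N + 1 - (k + 1)) =
        x * (∑ k ∈ Finset.range (N + 1),
          q ^ (k.choose 2) * gaussBin q N k * (x * q) ^ k * y ^ (N - k)) +
        y * ∑ k ∈ Finset.range N,
          q ^ ((k + 1).choose 2) * gaussBin q N (k + 1) * (x * q) ^ (k + 1) *
            y ^ (N - (k + 1)) := by
      have e2 : ∀ k ∈ Finset.range (N + 1), q ^ ((k + 1).choose 2) *
          (gaussBin q N k + q ^ (k + 1) * gaussBin q N (k + 1)) * x ^ (k + 1) *
          y ^ (N + 1 - (k + 1)) =
          x * (q ^ (k.choose 2) * gaussBin q N k * (x * q) ^ k * y ^ (N - k)) +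
          q ^ ((k + 1).choose 2) * gaussBin q N (k + 1) * (x * q) ^ (k + 1) * y ^ (N - k) := by
        intro k _
        rw [h3, Nat.add_sub_add_right]
        ring
      rw [Finset.sum_congr rfl e2, Finset.sum_add_distrib, ← Finset.mul_sum]
      congr 1
      rw [Finset.sum_range_succ, gaussBin_of_lt q N (N + 1) (by omega), Finset.mul_sum]
      simp only [mul_zero, zero_mul, add_zero]
      refine Finset.sum_congr rfl fun k hk => ?_
      have : N - k = (N - (k + 1)) + 1 := by
        have := Finset.mem_range.mp hk
        omega
      rw [this]
      ring
    rw [e1]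
    rw [Finset.sum_range_succ' (fun k => q ^ (k.choose 2) * gaussBin q N k * (x * q) ^ k *
      y ^ (N - k))]
    simp [gaussBin_zero_right]
    ring

theorem map_gaussBin {S : Type*} [CommRing S] (φ : R →+* S) :
    ∀ n k, gaussBin (φ q) n k = φ (gaussBin q n k)
  | _, 0 => by simp [gaussBin_zero_right]
  | 0, k + 1 => by simp [gaussBin]
  | n + 1, k + 1 => by
    simp [gaussBin_succ_succ, map_gaussBin φ n k, map_gaussBin φ n (k + 1)]

/-- Derivative of the finite triple product at the root. -/
theorem finite_jacobi (n : ℕ) :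
    (-1) ^ (n + 1) * q ^ (n + n.choose 2 + n * n) * qPoch q n ^ 2 =
      ∑ j ∈ Finset.range (2 * n + 2),
        (-1) ^ j * (j : R) * q ^ (j.choose 2 + n * (2 * n + 1 - j)) * gaussBin q (2 * n + 1) j := by
  have key := cauchy_binomial (Polynomial.C q) (2 * n + 1) (-Polynomial.X) (Polynomial.C q ^ n)
  have key2 := congrArg (fun p => (Polynomial.derivative p).eval 1) key
  have hL : ∏ j ∈ Finset.range (2 * n + 1),
      (Polynomial.C q ^ n + -Polynomial.X * Polynomial.C q ^ j) =
      (1 - Polynomial.X) * (Polynomial.C (q ^ n) *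
        ((∏ j ∈ Finset.range n, (Polynomial.C q ^ n + -Polynomial.X * Polynomial.C q ^ j)) *
        ∏ j ∈ Finset.range n,
          (Polynomial.C q ^ n + -Polynomial.X * Polynomial.C q ^ (n + 1 + j)))) := by
    rw [show 2 * n + 1 = (n + 1) + n by ring, Finset.prod_range_add, Finset.prod_range_succ]
    simp only [Polynomial.C_pow]
    ring
  rw [hL] at key2
  have hA : ∏ j ∈ Finset.range n, (q ^ n - q ^ j) = (-1) ^ n * q ^ (n.choose 2) * qPoch q n := by
    have h1 : ∀ j ∈ Finset.range n, q ^ n - q ^ j = ((-1) * q ^ j) * (1 - q ^ (n - 1 - j + 1)) := by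
      intro j hj
      have hj := Finset.mem_range.mp hj
      have : q ^ n = q ^ j * q ^ (n - 1 - j + 1) := by
        rw [← pow_add]; congr 1; omega
      rw [this]; ring
    rw [Finset.prod_congr rfl h1, Finset.prod_mul_distrib, Finset.prod_mul_distrib,
      Finset.prod_range_reflect (fun i => 1 - q ^ (i + 1)) n, Finset.prod_pow_eq_pow_sum,
      Finset.sum_range_id, Nat.choose_two_right]
    simp [qPoch]
  have hB : ∏ j ∈ Finset.range n, (q ^ n - q ^ (n + 1 + j)) = q ^ (n * n) * qPoch q n := by
    have h1 : ∀ j ∈ Finset.range n, q ^ n - q ^ (n + 1 + j) = q ^ n * (1 - q ^ (j + 1)) := by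
      intro j hj
      ring
    rw [Finset.prod_congr rfl h1, Finset.prod_mul_distrib]
    simp [qPoch, pow_mul]
  rw [Polynomial.derivative_mul] at key2
  simp only [Polynomial.eval_add, Polynomial.eval_mul, Polynomial.eval_sub, Polynomial.eval_one,
    Polynomial.eval_X, sub_self, zero_mul, add_zero, Polynomial.eval_prod, Polynomial.eval_pow,
    Polynomial.eval_C, Polynomial.eval_neg, Polynomial.derivative_sub, Polynomial.derivative_one,
    Polynomial.derivative_X, Polynomial.derivative_sum, Polynomial.eval_finsetSum, Polynomial.eval_zero] at key2
  have h4 : ∀ a : R, q ^ n + -1 * a = q ^ n - a := fun a => by ring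
  simp only [h4, hA, hB] at key2
  have h5 : ∀ j, (Polynomial.derivative (Polynomial.C q ^ (j.choose 2) *
      gaussBin (Polynomial.C q) (2 * n + 1) j * (-Polynomial.X) ^ j *
      (Polynomial.C q ^ n) ^ (2 * n + 1 - j))).eval 1 =
      (-1) ^ j * (j : R) * q ^ (j.choose 2 + n * (2 * n + 1 - j)) * gaussBin q (2 * n + 1) j := by
    intro j
    have : (Polynomial.C q ^ (j.choose 2) *
      gaussBin (Polynomial.C q) (2 * n + 1) j * (-Polynomial.X) ^ j *
      (Polynomial.C q ^ n) ^ (2 * n + 1 - j)) =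
      Polynomial.C ((-1) ^ j * q ^ (j.choose 2 + n * (2 * n + 1 - j)) *
        gaussBin q (2 * n + 1) j) * Polynomial.X ^ j := by
      rw [map_gaussBin q Polynomial.C, neg_pow]
      simp only [Polynomial.C_mul, Polynomial.C_pow, Polynomial.C_neg, Polynomial.C_1, pow_add,
        pow_mul]
      ring
    rw [this, Polynomial.derivative_C_mul_X_pow]
    simp
    ring
  rw [Finset.sum_congr rfl fun j _ => h5 j] at key2
  rw [← key2]
  ring

end General

/-- Euler's product modulo 5. -/
noncomputable abbrev eul : (ZMod 5)⟦X⟧ := pentagonalSeries (ZMod 5)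

instance fact_prime_five : Fact (Nat.Prime 5) := ⟨by norm_num⟩

theorem dvd_prod_sub_one (n : ℕ) (s : Finset ℕ) (hs : ∀ i ∈ s, n ≤ i) :
    (X : (ZMod 5)⟦X⟧) ^ (n + 1) ∣ ∏ i ∈ s, (1 - X ^ (i + 1)) - 1 := by
  induction s using Finset.induction_on with
  | empty => simp
  | insert a s ha ih =>
    rw [Finset.prod_insert ha]
    have h1 := ih fun i hi => hs i (Finset.mem_insert_of_mem hi)
    have h2 : (X : (ZMod 5)⟦X⟧) ^ (n + 1) ∣ X ^ (a + 1) :=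
      pow_dvd_pow _ (by have := hs a (Finset.mem_insert_self _ _); omega)
    have := dvd_sub h1 (h2.mul_right (∏ i ∈ s, (1 - X ^ (i + 1))))
    convert this using 1
    ring

theorem qPoch_dvd (n m : ℕ) (h : m ≤ n) :
    (X : (ZMod 5)⟦X⟧) ^ (m + 1) ∣ eul - qPoch X n := by
  rw [X_pow_dvd_iff]
  intro d hd
  obtain ⟨s, hs⟩ := Filter.eventually_atTop.mp
    (coeff_prod_one_sub_X_pow_eventually_eq (ZMod 5) d)
  have h1 := hs (s ∪ Finset.range n) Finset.subset_union_left
  have h2 : ∏ i ∈ s ∪ Finset.range n, (1 - (X : (ZMod 5)⟦X⟧) ^ (i + 1)) - qPoch X n =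
      qPoch X n * (∏ i ∈ (s ∪ Finset.range n) \ Finset.range n, (1 - X ^ (i + 1)) - 1) := by
    rw [← Finset.prod_sdiff (Finset.subset_union_right : Finset.range n ⊆ s ∪ Finset.range n)]
    unfold qPoch
    ring
  have h3 : (X : (ZMod 5)⟦X⟧) ^ (m + 1) ∣
      ∏ i ∈ s ∪ Finset.range n, (1 - (X : (ZMod 5)⟦X⟧) ^ (i + 1)) - qPoch X n := by
    rw [h2]
    refine Dvd.dvd.mul_left ?_ _
    refine dvd_prod_sub_one m _ fun i hi => ?_
    simp only [Finset.mem_sdiff, Finset.mem_range] at hi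
    omega
  rw [X_pow_dvd_iff] at h3
  have h4 := h3 d hd
  rw [map_sub, h1] at h4
  rw [map_sub]
  exact h4

theorem isUnit_eul : IsUnit eul := by
  rw [isUnit_iff_constantCoeff]
  have h := qPoch_dvd 0 0 le_rfl
  rw [X_pow_dvd_iff] at h
  have := h 0 (by norm_num)
  simp only [qPoch, Finset.range_zero, Finset.prod_empty, map_sub, coeff_zero_eq_constantCoeff,
    map_one, sub_eq_zero] at this
  have h2 : constantCoeff eul = 1 := by simpa using this
  rw [h2]
  exact isUnit_one

theorem qPoch_ne_zero (n : ℕ) : qPoch (X : (ZMod 5)⟦X⟧) n ≠ 0 := by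
  intro h
  have h1 := qPoch_dvd n 0 (Nat.zero_le _)
  rw [h, sub_zero] at h1
  have h2 : IsUnit (X : (ZMod 5)⟦X⟧) := isUnit_of_dvd_unit (by simpa using h1) isUnit_eul
  exact X_prime.not_isUnit h2

theorem gaussBin_symm (N k m : ℕ) (h : k + m = N) :
    gaussBin (X : (ZMod 5)⟦X⟧) N k = gaussBin X N m := by
  have h1 := gaussBin_mul (X : (ZMod 5)⟦X⟧) N k m h
  have h2 := gaussBin_mul (X : (ZMod 5)⟦X⟧) N m k (by omega)
  refine mul_right_cancel₀ (mul_ne_zero (qPoch_ne_zero k) (qPoch_ne_zero m)) ?_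
  linear_combination h1 - h2

theorem gaussBin_dvd (N k m t : ℕ) (h : k + m = N) (hk : t ≤ k) (hm : t ≤ m) :
    (X : (ZMod 5)⟦X⟧) ^ (t + 1) ∣ gaussBin X N k * eul - 1 := by
  have h1 := gaussBin_mul (X : (ZMod 5)⟦X⟧) N k m h
  obtain ⟨a, ha⟩ := qPoch_dvd k t hk
  obtain ⟨b, hb⟩ := qPoch_dvd m t hm
  obtain ⟨c, hc⟩ := qPoch_dvd N t (by omega)
  have h2 : (X : (ZMod 5)⟦X⟧) ^ (t + 1) ∣ (gaussBin X N k * eul - 1) * eul := by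
    refine ⟨gaussBin X N k * (a * qPoch X m + eul * b) - c, ?_⟩
    linear_combination h1 - hc + gaussBin X N k * (qPoch X m * ha + eul * hb)
  exact (isUnit_eul.dvd_mul_right).mp h2

theorem exists_exponent (n j : ℕ) (hj : j < 2 * n + 2) :
    ∃ T t : ℕ, j.choose 2 + n * (2 * n + 1 - j) = (n + n.choose 2 + n * n) + T ∧
      (8 * (T : ℤ) + 1 = (2 * j - (2 * n + 1)) ^ 2) ∧ t ≤ j ∧ t ≤ 2 * n + 1 - j ∧ n ≤ T + t := by
  have hc : ∀ m : ℕ, 2 * ((m.choose 2 : ℕ) : ℤ) = m * (m - 1) := by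
    intro m
    induction m with
    | zero => simp
    | succ m ih =>
      rw [Nat.choose_succ_succ' m 1, Nat.choose_one_right]
      push_cast
      linarith
  rcases Nat.lt_or_ge n j with h | h
  · obtain ⟨d, rfl⟩ : ∃ d, j = n + 1 + d := ⟨j - n - 1, by omega⟩
    obtain ⟨t, rfl⟩ : ∃ t, n = d + t := ⟨n - d, by omega⟩
    have hT := hc (d + 1)
    refine ⟨(d + 1).choose 2, t, ?_, ?_, by omega, by omega, ?_⟩
    · have h1 := hc (d + t + 1 + d)
      have h2 := hc (d + t)
      rw [show 2 * (d + t) + 1 - (d + t + 1 + d) = t by omega]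
      zify
      push_cast at *
      linarith
    · push_cast at *
      linarith
    · rw [Nat.choose_succ_succ' d 1, Nat.choose_one_right]
      omega
  · obtain ⟨d, rfl⟩ : ∃ d, n = j + d := ⟨n - j, by omega⟩
    have hT := hc (d + 1)
    refine ⟨(d + 1).choose 2, j, ?_, ?_, by omega, by omega, ?_⟩
    · have h1 := hc (j + d)
      have h2 := hc j
      rw [show 2 * (j + d) + 1 - j = j + 2 * d + 1 by omega]
      zify
      push_cast at *
      linarith
    · push_cast at *
      linarith
    · rw [Nat.choose_succ_succ' d 1, Nat.choose_one_right]
      omega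

theorem coeff_cube (b : ℕ) (hb : coeff b (eul ^ 3) ≠ 0) :
    ∃ w : ZMod 5, w ≠ 0 ∧ 8 * (b : ZMod 5) + 1 = w ^ 2 := by
  by_contra! hcon
  apply hb
  set n := b with hn
  have hJ := finite_jacobi (X : (ZMod 5)⟦X⟧) n
  set E0 := n + n.choose 2 + n * n with hE0
  set F : ℕ → (ZMod 5)⟦X⟧ := fun j =>
    (-1) ^ j * (j : (ZMod 5)⟦X⟧) * X ^ (j.choose 2 + n * (2 * n + 1 - j)) *
      gaussBin X (2 * n + 1) j with hF
  have hex : ∀ j : ℕ, ∃ T t : ℕ, j < 2 * n + 2 →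
      j.choose 2 + n * (2 * n + 1 - j) = E0 + T ∧
      (8 * (T : ℤ) + 1 = (2 * j - (2 * n + 1)) ^ 2) ∧ t ≤ j ∧ t ≤ 2 * n + 1 - j ∧ n ≤ T + t := by
    intro j
    by_cases hj : j < 2 * n + 2
    · obtain ⟨T, t, h⟩ := exists_exponent n j hj
      exact ⟨T, t, fun _ => h⟩
    · exact ⟨0, 0, fun h => absurd h hj⟩
  choose T t hT using hex
  have hrefl := Finset.sum_range_reflect F (2 * n + 2)
  have hsum : 2 * ((-1) ^ (n + 1) * X ^ E0 * qPoch (X : (ZMod 5)⟦X⟧) n ^ 2) =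
      X ^ E0 * ∑ j ∈ Finset.range (2 * n + 2),
        (-1) ^ j * C ((2 * j - (2 * n + 1) : ℤ) : ZMod 5) * X ^ (T j) *
          gaussBin X (2 * n + 1) j := by
    rw [hJ, two_mul]
    nth_rewrite 1 [← hrefl]
    rw [← Finset.sum_add_distrib, Finset.mul_sum]
    refine Finset.sum_congr rfl fun j hj => ?_
    have hj := Finset.mem_range.mp hj
    have hj' : 2 * n + 2 - 1 - j < 2 * n + 2 := by omega
    obtain ⟨a1, a2, -⟩ := hT j hj
    obtain ⟨b1, b2, -⟩ := hT _ hj'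
    have hTT : T (2 * n + 2 - 1 - j) = T j := by
      have : ((2 * n + 2 - 1 - j : ℕ) : ℤ) = 2 * n + 1 - j := by omega
      rw [this] at b2
      have : (T (2 * n + 2 - 1 - j) : ℤ) = T j := by nlinarith
      exact_mod_cast this
    simp only [hF]
    rw [b1, a1, hTT, gaussBin_symm (2 * n + 1) (2 * n + 2 - 1 - j) j (by omega)]
    have hs : ((-1 : (ZMod 5)⟦X⟧)) ^ (2 * n + 2 - 1 - j) = - (-1) ^ j := by
      have h1 : (-1 : (ZMod 5)⟦X⟧) ^ (2 * n + 2 - 1 - j) * (-1) ^ j = -1 := by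
        rw [← pow_add]
        exact Odd.neg_one_pow ⟨n, by omega⟩
      have h2 : (-1 : (ZMod 5)⟦X⟧) ^ j * (-1) ^ j = 1 := by
        rw [← mul_pow]; simp
      linear_combination (-1) ^ j * h1 - (-1 : (ZMod 5)⟦X⟧) ^ (2 * n + 2 - 1 - j) * h2
    have hc : ((2 * n + 2 - 1 - j : ℕ) : (ZMod 5)⟦X⟧) = 2 * n + 1 - j := by
      have : 2 * n + 2 - 1 - j = 2 * n + 1 - j := by omega
      rw [this, Nat.cast_sub (by omega)]
      push_cast
      ring
    rw [hs, hc]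
    push_cast
    simp only [map_sub, map_add, map_mul, map_natCast, map_ofNat, map_one, pow_add]
    ring
  have hX : (X : (ZMod 5)⟦X⟧) ^ E0 ≠ 0 := pow_ne_zero _ X_ne_zero
  have hsum2 : 2 * ((-1) ^ (n + 1) * qPoch (X : (ZMod 5)⟦X⟧) n ^ 2) =
      ∑ j ∈ Finset.range (2 * n + 2),
        (-1) ^ j * C ((2 * j - (2 * n + 1) : ℤ) : ZMod 5) * X ^ (T j) *
          gaussBin X (2 * n + 1) j := by
    apply mul_left_cancel₀ hX
    rw [← hsum]
    ring
  -- modulo `X ^ (n + 1)`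
  have hmod : (X : (ZMod 5)⟦X⟧) ^ (n + 1) ∣ 2 * ((-1) ^ (n + 1) * eul ^ 3) -
      ∑ j ∈ Finset.range (2 * n + 2),
        (-1) ^ j * C ((2 * j - (2 * n + 1) : ℤ) : ZMod 5) * X ^ (T j) := by
    have e1 : (X : (ZMod 5)⟦X⟧) ^ (n + 1) ∣
        2 * ((-1) ^ (n + 1) * eul * (eul ^ 2 - qPoch X n ^ 2)) := by
      obtain ⟨a, ha⟩ := qPoch_dvd n n le_rfl
      refine ⟨2 * ((-1) ^ (n + 1) * eul * (a * (eul + qPoch X n))), ?_⟩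
      linear_combination 2 * ((-1) ^ (n + 1) * eul * (eul + qPoch X n)) * ha
    have e2 : (X : (ZMod 5)⟦X⟧) ^ (n + 1) ∣ ∑ j ∈ Finset.range (2 * n + 2),
        (-1) ^ j * C ((2 * j - (2 * n + 1) : ℤ) : ZMod 5) * (X ^ (T j) *
          (gaussBin X (2 * n + 1) j * eul - 1)) := by
      refine Finset.dvd_sum fun j hj => Dvd.dvd.mul_left ?_ _
      have hj := Finset.mem_range.mp hj
      obtain ⟨-, -, h1, h2, h3⟩ := hT j hj
      have := gaussBin_dvd (2 * n + 1) j (2 * n + 1 - j) (t j) (by omega) h1 h2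
      refine dvd_trans ?_ (mul_dvd_mul_left (X ^ (T j)) this)
      rw [← pow_add]
      exact pow_dvd_pow _ (by omega)
    have e3 := dvd_add e1 e2
    convert e3 using 1
    have : ∑ j ∈ Finset.range (2 * n + 2),
        (-1) ^ j * C ((2 * j - (2 * n + 1) : ℤ) : ZMod 5) * (X ^ (T j) *
          (gaussBin X (2 * n + 1) j * eul - 1)) =
        (∑ j ∈ Finset.range (2 * n + 2),
        (-1) ^ j * C ((2 * j - (2 * n + 1) : ℤ) : ZMod 5) * X ^ (T j) *
          gaussBin X (2 * n + 1) j) * eul - ∑ j ∈ Finset.range (2 * n + 2),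
        (-1) ^ j * C ((2 * j - (2 * n + 1) : ℤ) : ZMod 5) * X ^ (T j) := by
      rw [Finset.sum_mul, ← Finset.sum_sub_distrib]
      exact Finset.sum_congr rfl fun j _ => by ring
    rw [this, ← hsum2]
    ring
  rw [X_pow_dvd_iff] at hmod
  have hcf := hmod n (by omega)
  have hz : coeff n (∑ j ∈ Finset.range (2 * n + 2),
        (-1) ^ j * C ((2 * j - (2 * n + 1) : ℤ) : ZMod 5) * (X : (ZMod 5)⟦X⟧) ^ (T j)) = 0 := by
    rw [map_sum]
    refine Finset.sum_eq_zero fun j hj => ?_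
    have hj := Finset.mem_range.mp hj
    obtain ⟨-, h1, -⟩ := hT j hj
    by_cases hw : ((2 * j - (2 * n + 1) : ℤ) : ZMod 5) = 0
    · rw [hw]; simp
    · have hne : n ≠ T j := by
        intro h
        apply hcon _ hw
        have := congrArg (Int.cast : ℤ → ZMod 5) h1
        rw [← h] at this
        push_cast at this ⊢
        exact this
      have e : ((-1) ^ j * C ((2 * j - (2 * n + 1) : ℤ) : ZMod 5) * (X : (ZMod 5)⟦X⟧) ^ (T j)) =
          C ((-1) ^ j * ((2 * j - (2 * n + 1) : ℤ) : ZMod 5)) * X ^ (T j) := by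
        simp
      rw [e, coeff_C_mul, coeff_X_pow, if_neg hne, mul_zero]
  rw [map_sub, hz, sub_zero] at hcf
  have e : 2 * ((-1) ^ (n + 1) * eul ^ 3) = C (2 * (-1) ^ (n + 1) : ZMod 5) * eul ^ 3 := by
    rw [map_mul, map_pow, map_neg, map_one, map_ofNat, mul_assoc]
  rw [e, coeff_C_mul] at hcf
  refine (mul_eq_zero.mp hcf).resolve_left ?_
  exact mul_ne_zero (by decide) (pow_ne_zero _ (by decide))

theorem coeff_fourth (N : ℕ) (hN : N % 5 = 4) : coeff N (eul ^ 4) = 0 := by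
  rw [show eul ^ 4 = eul * eul ^ 3 by ring, coeff_mul]
  refine Finset.sum_eq_zero fun p hp => ?_
  obtain ⟨a, b⟩ := p
  rw [Finset.HasAntidiagonal.mem_antidiagonal] at hp
  simp only at hp ⊢
  by_contra hne
  have ha : coeff a eul ≠ 0 := left_ne_zero_of_mul hne
  obtain ⟨w, hw, hb⟩ := coeff_cube b (right_ne_zero_of_mul hne)
  have ha' : a ∈ Set.range pentagonal := by
    by_contra h
    exact ha (coeff_pentagonalSeries_eq_zero _ h)
  obtain ⟨i, rfl⟩ := ha'
  have h1 := congrArg (Int.cast : ℤ → ZMod 5) (two_mul_natCast_pentagonal i)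
  push_cast at h1
  have h2 : ((pentagonal i : ℕ) : ZMod 5) + b = 4 := by
    have : ((pentagonal i + b : ℕ) : ZMod 5) = ((4 : ℕ) : ZMod 5) := by
      rw [ZMod.natCast_eq_natCast_iff, hp]
      exact hN
    exact_mod_cast this
  generalize ((pentagonal i : ℕ) : ZMod 5) = A at h1 h2
  generalize (b : ZMod 5) = B at hb h2
  generalize (i : ZMod 5) = I at h1
  clear * - hw hb h1 h2
  revert hw hb h1 h2
  revert w A B I
  decide

/-- Generating function of partitions with parts satisfying `p`. -/
noncomputable def gf (p : ℕ → Prop) [DecidablePred p] : (ZMod 5)⟦X⟧ :=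
  PowerSeries.mk fun n => ((Nat.Partition.restricted n p).card : ZMod 5)

open WithPiTopology in
theorem gf_mul_eul : gf (fun _ => True) * eul = 1 := by
  let _ : TopologicalSpace (ZMod 5) := ⊥
  have _ : DiscreteTopology (ZMod 5) := ⟨rfl⟩
  have h1 := Nat.Partition.hasProd_powerSeriesMk_card_restricted (ZMod 5) (fun _ => True)
  have h2 := WithPiTopology.hasProd_one_sub_X_pow (ZMod 5)
  have h3 := h1.mul h2
  refine h3.unique ?_
  convert hasProd_one using 2 with i
  simp only [if_true, pow_mul]
  rw [WithPiTopology.tsum_pow_mul_one_sub_of_constantCoeff_eq_zero (by simp)]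

theorem pow_five (g : (ZMod 5)⟦X⟧) : g ^ 5 = expand 5 (by norm_num) g := by
  have h := MvPowerSeries.map_frobenius_expand (R := ZMod 5) (σ := Unit) 5 (by norm_num) (f := g)
  rw [ZMod.frobenius_zmod] at h
  rw [MvPowerSeries.map_id] at h
  exact h.symm

theorem coeff_main (n : ℕ) (O : (ZMod 5)⟦X⟧) :
    coeff (5 * n + 4) (gf (fun _ => True) * O ^ 10) = 0 := by
  have h : gf (fun _ => True) * O ^ 10 =
      eul ^ 4 * expand 5 (by norm_num) (gf (fun _ => True) * O ^ 2) := by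
    rw [← pow_five]
    have h4 : (gf (fun _ => True) * eul) ^ 4 = 1 := by rw [gf_mul_eul, one_pow]
    linear_combination (-(gf (fun _ => True) * O ^ 10)) * h4
  rw [h, coeff_mul]
  refine Finset.sum_eq_zero fun p hp => ?_
  obtain ⟨a, b⟩ := p
  rw [Finset.HasAntidiagonal.mem_antidiagonal] at hp
  simp only at hp ⊢
  by_cases hb : 5 ∣ b
  · rw [coeff_fourth a (by omega), zero_mul]
  · rw [coeff_expand_of_not_dvd 5 _ _ hb, mul_zero]

/-- The condition on the parts of the `i`-th partition. -/
def partCond (i : Fin 11) (x : ℕ) : Prop := i.val ≠ 0 → Odd x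

instance decCond (i : Fin 11) : DecidablePred (partCond i) := fun x => by
  unfold partCond; infer_instance

/-- The multisets of size `m` allowed in position `i`. -/
noncomputable def parts (i : Fin 11) (m : ℕ) : Finset (Multiset ℕ) :=
  (Nat.Partition.restricted m (partCond i)).image Nat.Partition.parts

theorem card_parts (i : Fin 11) (m : ℕ) :
    (parts i m).card = (Nat.Partition.restricted m (partCond i)).card :=
  Finset.card_image_of_injective _ fun _ _ h => Nat.Partition.ext h

theorem mem_parts (i : Fin 11) (m : ℕ) (s : Multiset ℕ) :
    s ∈ parts i m ↔ (∀ x ∈ s, 0 < x) ∧ (∀ x ∈ s, partCond i x) ∧ s.sum = m := by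
  simp only [parts, Finset.mem_image, Nat.Partition.restricted, Finset.mem_filter,
    Finset.mem_univ, true_and]
  constructor
  · rintro ⟨p, hp, rfl⟩
    exact ⟨fun x hx => p.parts_pos hx, hp, p.parts_sum⟩
  · rintro ⟨h1, h2, h3⟩
    exact ⟨⟨s, fun {x} hx => h1 x hx, h3⟩, h2, rfl⟩

theorem colored_eq (n : ℕ) : coloredPartition 11 n =
    ∑ l ∈ Finset.finsuppAntidiag (Finset.univ : Finset (Fin 11)) n,
      ∏ i, (Nat.Partition.restricted (l i) (partCond i)).card := by
  have hset : {c : Fin 11 → Multiset ℕ |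
    (∀ i, ∀ x ∈ c i, 0 < x) ∧
    (∀ i : Fin 11, i.val ≠ 0 → ∀ x ∈ c i, Odd x) ∧
    (∑ i, (c i).sum) = n} =
    ((Finset.finsuppAntidiag (Finset.univ : Finset (Fin 11)) n).biUnion
      fun l => Fintype.piFinset fun i => parts i (l i) : Finset (Fin 11 → Multiset ℕ)) := by
    ext c
    simp only [Set.mem_ofPred_eq, Finset.coe_biUnion, Set.mem_iUnion, Finset.mem_coe,
      Fintype.mem_piFinset, mem_parts, Finset.mem_finsuppAntidiag, exists_prop]
    constructor
    · rintro ⟨h1, h2, h3⟩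
      refine ⟨Finsupp.equivFunOnFinite.symm fun i => (c i).sum, ⟨?_, by simp⟩, fun i =>
        ⟨h1 i, fun x hx hi => h2 i hi x hx, by simp⟩⟩
      simpa using h3
    · rintro ⟨l, ⟨h1, -⟩, h2⟩
      refine ⟨fun i => (h2 i).1, fun i hi x hx => (h2 i).2.1 x hx hi, ?_⟩
      rw [← h1]
      exact Finset.sum_congr rfl fun i _ => (h2 i).2.2
  unfold coloredPartition
  rw [hset, Set.ncard_coe_finset, Finset.card_biUnion]
  · refine Finset.sum_congr rfl fun l _ => ?_
    rw [Fintype.card_piFinset]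
    exact Finset.prod_congr rfl fun i _ => card_parts i (l i)
  · intro l _ l' _ hne
    rw [Function.onFun, Finset.disjoint_left]
    intro c hc hc'
    apply hne
    ext i
    rw [Fintype.mem_piFinset] at hc hc'
    rw [← ((mem_parts _ _ _).mp (hc i)).2.2, ← ((mem_parts _ _ _).mp (hc' i)).2.2]

theorem colored_cast (n : ℕ) :
    (coloredPartition 11 n : ZMod 5) = coeff n (gf (fun _ => True) * gf (fun x => Odd x) ^ 10) := by
  have h0 : gf (partCond 0) = gf (fun _ => True) := by
    unfold gf
    congr 1
    funext m
    congr 2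
    simp [Nat.Partition.restricted, partCond]
  have h1 : ∀ i : Fin 10, gf (partCond i.succ) = gf (fun x => Odd x) := by
    intro i
    unfold gf
    congr 1
    funext m
    congr 2
    simp [Nat.Partition.restricted, partCond]
  have hp : ∏ i : Fin 11, gf (partCond i) = gf (fun _ => True) * gf (fun x => Odd x) ^ 10 := by
    rw [Fin.prod_univ_succ, h0, Finset.prod_congr rfl fun i _ => h1 i]
    simp
  rw [← hp, coeff_prod, colored_eq]
  push_cast
  simp [gf]

end ColoredAux

/-- Ramanujan-type congruence: `a_{11}(5n + 4) ≡ 0 (mod 5)` for all `n ≥ 0`. -/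
theorem coloredPartition_eleven_mod_five (n : ℕ) :
    5 ∣ coloredPartition 11 (5 * n + 4) := by
  rw [← ZMod.natCast_eq_zero_iff, ColoredAux.colored_cast]
  exact ColoredAux.coeff_main n _
end

section
/- For all integers n ≥ 0, the number a_{11}(7n + 4) is divisible by 7. -/
namespace Jac
open PowerSeries Finset

abbrev A := PowerSeries (ZMod 7)

instance : Fact (Nat.Prime 7) := ⟨by norm_num⟩

noncomputable def p (n : ℕ) : A := ∏ i ∈ range n, (1 - X ^ (i + 1))

lemma p_zero : p 0 = 1 := by simp [p]
lemma p_succ (n : ℕ) : p (n + 1) = p n * (1 - X ^ (n + 1)) := by simp [p, prod_range_succ]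

noncomputable def qb : ℕ → ℕ → A
  | _, 0 => 1
  | 0, _ + 1 => 0
  | n + 1, k + 1 => qb n k + X ^ (k + 1) * qb n (k + 1)

lemma qb_zero (n : ℕ) : qb n 0 = 1 := by cases n <;> rfl
lemma qb_succ (n k : ℕ) : qb (n + 1) (k + 1) = qb n k + X ^ (k + 1) * qb n (k + 1) := rfl

lemma qb_lt : ∀ n k : ℕ, n < k → qb n k = 0
  | 0, 0, h => by omega
  | _ + 1, 0, h => by omega
  | 0, k + 1, _ => rfl
  | n + 1, k + 1, h => by
    rw [qb_succ, qb_lt n k (by omega), qb_lt n (k + 1) (by omega)]; simp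

lemma qb_self : ∀ n : ℕ, qb n n = 1
  | 0 => rfl
  | n + 1 => by rw [qb_succ, qb_self n, qb_lt n (n + 1) (by omega)]; simp

lemma qb_mul (s : ℕ) : ∀ k m : ℕ, k + m = s → qb s k * p k * p m = p s := by
  induction s with
  | zero =>
    intro k m h
    obtain rfl : k = 0 := by omega
    obtain rfl : m = 0 := by omega
    simp [qb_zero, p_zero]
  | succ s ih =>
    intro k m h
    rcases k with _ | k
    · obtain rfl : m = s + 1 := by omega
      simp [qb_zero, p_zero]
    rcases m with _ | m
    · obtain rfl : s = k := by omega
      simp [qb_self, p_zero]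
    have h1 := ih k (m + 1) (by omega)
    have h2 := ih (k + 1) m (by omega)
    have e : s = k + m + 1 := by omega
    rw [qb_succ]
    calc _ = (qb s k * p k * p (m + 1)) * (1 - X ^ (k + 1))
          + X ^ (k + 1) * ((qb s (k + 1) * p (k + 1) * p m) * (1 - X ^ (m + 1))) := by
            rw [p_succ k, p_succ m]; ring
      _ = p (s + 1) := by
            rw [h1, h2, p_succ s, e]; ring

lemma qbinom {B : Type*} [CommRing B] [Algebra A B] (x : B) (N : ℕ) : ∀ y : B,
    ∏ i ∈ range N, (x - y * algebraMap A B (X ^ i)) =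
      ∑ k ∈ range (N + 1), algebraMap A B ((-1) ^ k * X ^ (k.choose 2) * qb N k) *
        y ^ k * x ^ (N - k) := by
  induction N with
  | zero => intro y; simp [qb_zero]
  | succ N ih =>
    intro y
    rw [prod_range_succ']
    have e : ∀ i ∈ range N, (x - y * algebraMap A B (X ^ (i + 1))) =
        (x - (y * algebraMap A B X) * algebraMap A B (X ^ i)) := by
      intro i _
      rw [pow_succ, map_mul]; ring
    rw [prod_congr rfl e, ih]
    have hb : ∑ k ∈ range (N + 1 + 1),
        algebraMap A B ((-1) ^ k * X ^ (k.choose 2 + k) * qb N k) * y ^ k * x ^ (N + 1 - k) =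
        (∑ k ∈ range (N + 1), algebraMap A B ((-1) ^ k * X ^ (k.choose 2) * qb N k) *
        (y * algebraMap A B X) ^ k * x ^ (N - k)) * x := by
      rw [sum_range_succ, qb_lt N (N + 1) (by omega), sum_mul]
      simp only [mul_zero, map_zero, zero_mul, add_zero]
      refine sum_congr rfl fun k hk => ?_
      have hk : k ≤ N := by simpa [Nat.lt_succ_iff] using hk
      rw [show N + 1 - k = (N - k) + 1 by omega]
      simp only [map_mul, map_pow, pow_add, mul_pow]
      ring
    rw [pow_zero, map_one, mul_one, mul_sub, ← hb, sum_range_succ', sum_range_succ' _ (N + 1),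
      sum_mul, add_sub_right_comm, ← sum_sub_distrib]
    congr 1
    · refine sum_congr rfl fun k hk => ?_
      rw [show N + 1 - (k + 1) = N - k by omega, qb_succ, Nat.choose_succ_succ' k 1,
        Nat.choose_one_right]
      simp only [map_mul, map_pow, pow_add, mul_pow, map_add, map_neg, map_one]
      ring
    · simp [qb_zero]

lemma p_congr (c a : ℕ) (h : c ≤ a) : (X : A) ^ (c + 1) ∣ p a - p c := by
  induction a, h using Nat.le_induction with
  | base => simp
  | succ a h ih =>
    have : p (a + 1) - p c = (p a - p c) - X ^ (a + 1) * p a := by rw [p_succ]; ring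
    rw [this]
    exact dvd_sub ih (Dvd.dvd.mul_right (pow_dvd_pow _ (by omega)) _)

lemma p_unit (n : ℕ) : IsUnit (p n) := by
  rw [PowerSeries.isUnit_iff_constantCoeff]
  simp [p, map_prod]

lemma qb_congr (n c k m s : ℕ) (hs : k + m = s) (hk : c ≤ k) (hm : c ≤ m) (hn : c ≤ n) :
    (X : A) ^ (c + 1) ∣ qb s k * p n - 1 := by
  have h := qb_mul s k m hs
  rw [← (p_unit c).dvd_mul_right]
  have e : (qb s k * p n - 1) * p c =
    qb s k * p c * (p n - p c) - qb s k * p c * (p m - p c) - qb s k * p m * (p k - p c)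
     + (p s - p c) := by rw [← h]; ring
  rw [e]
  refine dvd_add (dvd_sub (dvd_sub ?_ ?_) ?_) (p_congr _ _ (by omega)) <;>
  exact Dvd.dvd.mul_left (p_congr _ _ (by omega)) _

lemma prod_pow_id (n : ℕ) : ∏ i ∈ range n, (X : A) ^ i = X ^ (n.choose 2) := by
  induction n with
  | zero => simp
  | succ n ih =>
    rw [prod_range_succ, ih, Nat.choose_succ_succ' n 1, Nat.choose_one_right, pow_add, mul_comm]

lemma prod_low (n : ℕ) : ∏ i ∈ range n, ((X : A) ^ n - X ^ i) =
    (-1) ^ n * X ^ (n.choose 2) * p n := by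
  have e : ∀ i ∈ range n, ((X : A) ^ n - X ^ i) = (-1) * X ^ i * (1 - X ^ (n - 1 - i + 1)) := by
    intro i hi
    have hi := mem_range.mp hi
    have : n = i + (n - 1 - i + 1) := by omega
    conv_lhs => rw [this, pow_add]
    ring
  rw [prod_congr rfl e, prod_mul_distrib, prod_mul_distrib, prod_pow_id, prod_const, card_range,
    prod_range_reflect (fun i => (1 : A) - X ^ (i + 1)) n, p]

lemma prod_high (n : ℕ) : ∏ i ∈ range n, ((X : A) ^ n - X ^ (n + 1 + i)) =
    X ^ (n * n) * p n := by
  have e : ∀ i ∈ range n, ((X : A) ^ n - X ^ (n + 1 + i)) = X ^ n * (1 - X ^ (i + 1)) := by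
    intro i _
    rw [add_assoc, pow_add, add_comm 1 i]; ring
  rw [prod_congr rfl e, prod_mul_distrib, prod_const, card_range, ← pow_mul, p]

/-- finite Jacobi -/
lemma jac_deriv (n : ℕ) :
    (-1) ^ n * X ^ (n.choose 2 + n * n) * p n ^ 2 =
      ∑ k ∈ range (2 * n + 1), (-1) ^ k * X ^ (k.choose 2 + n * (2 * n - k)) *
        ((2 * n + 1 - k : ℕ) : A) * qb (2 * n + 1) k := by
  have h := congrArg (fun P => (Polynomial.derivative P).eval ((X : A) ^ n))
    (qbinom (Polynomial.X : Polynomial A) (2 * n + 1) 1)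
  have hl : ∏ i ∈ range (2 * n + 1), ((Polynomial.X : Polynomial A) -
      1 * algebraMap A (Polynomial A) (X ^ i)) =
      ((∏ i ∈ range n, ((Polynomial.X : Polynomial A) - Polynomial.C (X ^ i))) *
      (∏ i ∈ range n, ((Polynomial.X : Polynomial A) - Polynomial.C (X ^ (n + 1 + i))))) *
      (Polynomial.X - Polynomial.C (X ^ n)) := by
    simp only [one_mul, Polynomial.algebraMap_eq]
    rw [show 2 * n + 1 = (n + 1) + n by ring, prod_range_add, prod_range_succ]
    ring
  rw [hl] at h
  simp only [Polynomial.derivative_mul, Polynomial.eval_add, Polynomial.eval_mul,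
    Polynomial.eval_sub, Polynomial.eval_X, Polynomial.eval_C, sub_self, mul_zero, zero_add,
    Polynomial.derivative_sub, Polynomial.derivative_X, Polynomial.derivative_C, sub_zero,
    mul_one, Polynomial.eval_prod, one_pow, Polynomial.algebraMap_eq,
    Polynomial.derivative_sum, Polynomial.eval_finsetSum, zero_mul, Polynomial.derivative_X_pow,
    Polynomial.eval_pow, prod_low, prod_high] at h
  rw [sum_range_succ] at h
  simp only [Nat.sub_self, Nat.cast_zero, zero_mul, mul_zero, add_zero] at h
  calc _ = (-1) ^ n * X ^ (n.choose 2) * p n * (X ^ (n * n) * p n) := by rw [pow_add]; ring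
    _ = _ := h
    _ = _ := by
      refine sum_congr rfl fun k hk => ?_
      rw [show 2 * n + 1 - k - 1 = 2 * n - k by omega, pow_add, pow_mul]
      ring

lemma choose_two_mul (n : ℕ) : (n + 1).choose 2 * 2 = (n + 1) * n := by
  have := Nat.choose_two_right (n + 1)
  rw [this]
  simp only [Nat.add_sub_cancel]
  exact Nat.div_mul_cancel (by rw [mul_comm]; exact (Nat.even_mul_succ_self n).two_dvd)

lemma choose_two_mul_cast (n : ℕ) : (n.choose 2 : ℤ) * 2 = n * (n - 1) := by
  rcases n with _ | n
  · simp
  · have := choose_two_mul n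
    push_cast
    rw [add_sub_cancel_right]
    exact_mod_cast this

lemma exp_low (n j : ℕ) (hj : j ≤ n) :
    (n - j).choose 2 + n * (2 * n - (n - j)) = (n.choose 2 + n * n) + (j + 1).choose 2 := by
  obtain ⟨m, rfl⟩ := Nat.exists_eq_add_of_le hj
  rw [show j + m - j = m by omega, show 2 * (j + m) - m = 2 * j + m by omega]
  have h1 := choose_two_mul_cast m
  have h2 := choose_two_mul_cast (j + m)
  have h3 := choose_two_mul_cast (j + 1)
  push_cast at h1 h2 h3
  zify
  linarith

lemma exp_high (n j : ℕ) (hj : j < n) :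
    (n + 1 + j).choose 2 + n * (2 * n - (n + 1 + j)) =
      (n.choose 2 + n * n) + (j + 1).choose 2 := by
  obtain ⟨m, rfl⟩ := Nat.exists_eq_add_of_lt hj
  rw [show 2 * (j + m + 1) - (j + m + 1 + 1 + j) = m by omega]
  have h1 := choose_two_mul_cast (j + m + 1 + 1 + j)
  have h2 := choose_two_mul_cast (j + m + 1)
  have h3 := choose_two_mul_cast (j + 1)
  push_cast at h1 h2 h3
  zify
  linarith

lemma sgn_sub (n j : ℕ) (hj : j ≤ n) : (-1 : A) ^ (n - j) = (-1) ^ n * (-1) ^ j := by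
  obtain ⟨m, rfl⟩ := Nat.exists_eq_add_of_le hj
  have h : (-1 : A) ^ j * (-1) ^ j = 1 := by
    rw [← mul_pow, neg_one_mul, neg_neg, one_pow]
  rw [show j + m - j = m by omega, pow_add, mul_right_comm, h, one_mul]

set_option maxHeartbeats 1000000 in
lemma jac_fin (n : ℕ) :
    p n ^ 2 = ∑ j ∈ range (n + 1), (-1) ^ j * X ^ ((j + 1).choose 2) *
      (((n + 1 + j : ℕ) : A) * qb (2 * n + 1) (n - j) -
       ((n - j : ℕ) : A) * qb (2 * n + 1) (n + 1 + j)) := by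
  have h := jac_deriv n
  have hne : ((-1 : A) ^ n * X ^ (n.choose 2 + n * n)) ≠ 0 :=
    mul_ne_zero (pow_ne_zero _ (neg_ne_zero.mpr one_ne_zero)) (pow_ne_zero _ X_ne_zero)
  apply mul_left_cancel₀ hne
  rw [h, show 2 * n + 1 = (n + 1) + n by ring, sum_range_add, ← sum_range_reflect _ (n + 1),
    mul_sum]
  simp only [mul_sub, sum_sub_distrib]
  rw [sub_eq_add_neg, ← sum_neg_distrib]
  congr 1
  · refine sum_congr rfl fun j hj => ?_
    have hj : j ≤ n := by simpa [Nat.lt_succ_iff] using hj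
    rw [show n + 1 - 1 - j = n - j by omega, exp_low n j hj,
      show n + 1 + n - (n - j) = n + 1 + j by omega, pow_add]
    rw [sgn_sub n j hj]; ring
  · rw [sum_range_succ]
    simp only [Nat.sub_self, Nat.cast_zero, zero_mul, mul_zero, neg_zero, add_zero]
    refine sum_congr rfl fun j hj => ?_
    rw [exp_high n j (mem_range.mp hj), show n + 1 + n - (n + 1 + j) = n - j by omega]
    rw [pow_add (-1 : A) (n + 1) j, pow_add (-1 : A) n 1, pow_one, pow_add X]
    ring

lemma jac_congr (n : ℕ) :
    (X : A) ^ (n + 1) ∣ p n ^ 3 - ∑ j ∈ range (n + 1), (-1) ^ j * X ^ ((j + 1).choose 2) *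
      ((2 * j + 1 : ℕ) : A) := by
  have e : p n ^ 3 = p n ^ 2 * p n := by ring
  rw [e, jac_fin, sum_mul, ← sum_sub_distrib]
  refine dvd_sum fun j hj => ?_
  have hj : j ≤ n := by simpa [Nat.lt_succ_iff] using hj
  have h1 := qb_congr n (n - j) (n - j) (n + 1 + j) (2 * n + 1) (by omega) le_rfl (by omega) (by omega)
  have h2 := qb_congr n (n - j) (n + 1 + j) (n - j) (2 * n + 1) (by omega) (by omega) le_rfl (by omega)
  have h3 : ((2 * j + 1 : ℕ) : A) = ((n + 1 + j : ℕ) : A) - ((n - j : ℕ) : A) := by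
    rw [eq_sub_iff_add_eq, ← Nat.cast_add]; congr 1; omega
  rw [h3]
  have h4 : n + 1 ≤ (j + 1).choose 2 + (n - j + 1) := by
    have : j ≤ (j + 1).choose 2 := by
      rw [Nat.choose_succ_succ' j 1]; simp
    omega
  refine (pow_dvd_pow _ h4).trans ?_
  rw [pow_add]
  have e2 : ∀ s t a b c u v : A, s * t * (a * u - b * v) * c - s * t * (a - b) =
     t * (s * a * (u * c - 1) - s * b * (v * c - 1)) := by intros; ring
  rw [e2]
  exact mul_dvd_mul_left _ (dvd_sub (Dvd.dvd.mul_left h1 _) (Dvd.dvd.mul_left h2 _))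

lemma arith7 : ∀ a < 7, ∀ b < 7, (b * (2 % 7)) % 7 = ((a + 1 % 7) % 7 * a) % 7 →
    (b ≠ 0 ∧ b ≠ 1 ∧ b ≠ 3) → a = 3 := by
  intro a ha b hb h1 h2
  interval_cases a <;> omega

lemma tri7 (d j : ℕ) (h : d % 7 ≠ 0 ∧ d % 7 ≠ 1 ∧ d % 7 ≠ 3) (hdj : d = (j + 1).choose 2) :
    7 ∣ 2 * j + 1 := by
  have h2 : d * 2 = (j + 1) * j := by rw [hdj, choose_two_mul]
  have h3 : (d * 2) % 7 = ((j + 1) * j) % 7 := by rw [h2]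
  rw [Nat.mul_mod, Nat.mul_mod (j + 1), Nat.add_mod] at h3
  have := arith7 (j % 7) (Nat.mod_lt _ (by norm_num)) (d % 7) (Nat.mod_lt _ (by norm_num)) h3 h
  omega

lemma coeff_p3 (n d : ℕ) (hd : d ≤ n) (h : d % 7 ≠ 0 ∧ d % 7 ≠ 1 ∧ d % 7 ≠ 3) :
    coeff d (p n ^ 3) = 0 := by
  have h1 := (X_pow_dvd_iff.mp (jac_congr n)) d (by omega)
  rw [map_sub, sub_eq_zero] at h1
  rw [h1, map_sum]
  refine sum_eq_zero fun j _ => ?_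
  have : (-1 : A) ^ j * X ^ ((j + 1).choose 2) * ((2 * j + 1 : ℕ) : A)
     = C ((-1 : ZMod 7) ^ j * ((2 * j + 1 : ℕ) : ZMod 7)) * X ^ ((j + 1).choose 2) := by
    simp only [map_mul, map_pow, map_neg, map_one, map_natCast]; ring
  rw [this, coeff_C_mul, coeff_X_pow]
  split_ifs with hdj
  · have := tri7 d j h hdj
    rw [(ZMod.natCast_eq_zero_iff _ _).mpr this]; simp
  · simp

open Classical in
lemma card_tuple (k n : ℕ) (P : Fin k → ℕ → Prop) :
    Set.ncard {c : Fin k → Multiset ℕ | (∀ i, ∀ x ∈ c i, 0 < x ∧ P i x) ∧ (∑ i, (c i).sum) = n} =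
    ∑ l ∈ finsuppAntidiag (univ : Finset (Fin k)) n,
      ∏ i, #(Nat.Partition.restricted (l i) (P i)) := by
  let T : Fin k → ℕ → Finset (Multiset ℕ) := fun i m =>
    (Nat.Partition.restricted m (P i)).image Nat.Partition.parts
  have hT : ∀ i m c, c ∈ T i m ↔ (∀ x ∈ c, 0 < x ∧ P i x) ∧ c.sum = m := by
    intro i m c
    simp only [T, mem_image, Nat.Partition.restricted, mem_filter, mem_univ, true_and]
    constructor
    · rintro ⟨a, ha, rfl⟩
      exact ⟨fun x hx => ⟨a.parts_pos hx, ha x hx⟩, a.parts_sum⟩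
    · rintro ⟨h1, h2⟩
      exact ⟨⟨c, fun {x} hx => (h1 x hx).1, h2⟩, fun x hx => (h1 x hx).2, rfl⟩
  have hcard : ∀ i m, #(T i m) = #(Nat.Partition.restricted m (P i)) := by
    intro i m
    exact card_image_of_injective _ (fun a b h => Nat.Partition.ext h)
  let U := (finsuppAntidiag (univ : Finset (Fin k)) n).biUnion
    (fun l => Fintype.piFinset (fun i => T i (l i)))
  have hU : {c : Fin k → Multiset ℕ |
      (∀ i, ∀ x ∈ c i, 0 < x ∧ P i x) ∧ (∑ i, (c i).sum) = n} = (U : Set _) := by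
    ext c
    simp only [U, Set.mem_ofPred_eq, coe_biUnion, Set.mem_iUnion, mem_coe, Fintype.mem_piFinset, hT,
      mem_finsuppAntidiag]
    constructor
    · rintro ⟨h1, h2⟩
      exact ⟨Finsupp.equivFunOnFinite.symm (fun i => (c i).sum), ⟨by simpa using h2, by simp⟩,
        fun i => ⟨h1 i, by simp⟩⟩
    · rintro ⟨l, ⟨h1, _⟩, h2⟩
      refine ⟨fun i => (h2 i).1, ?_⟩
      rw [← h1]
      exact sum_congr rfl fun i _ => (h2 i).2
  rw [hU, Set.ncard_coe_finset, card_biUnion]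
  · simp only [Fintype.card_piFinset, hcard]
  · intro l _ l' _ hne
    rw [Function.onFun, disjoint_left]
    intro c hc hc'
    apply hne
    ext i
    rw [Fintype.mem_piFinset] at hc hc'
    rw [← ((hT _ _ _).mp (hc i)).2, ← ((hT _ _ _).mp (hc' i)).2]

open Classical in
noncomputable def G (P : ℕ → Prop) : A :=
  PowerSeries.mk fun n => (#(Nat.Partition.restricted n P) : ZMod 7)

lemma cast_colored (n : ℕ) :
    (coloredPartition 11 n : ZMod 7) = coeff n (G (fun _ => True) * G (¬ 2 ∣ ·) ^ 10) := by
  classical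
  have h := card_tuple 11 n (fun i x => i.val ≠ 0 → ¬ 2 ∣ x)
  have hs : coloredPartition 11 n = Set.ncard {c : Fin 11 → Multiset ℕ |
      (∀ i, ∀ x ∈ c i, 0 < x ∧ (i.val ≠ 0 → ¬ 2 ∣ x)) ∧ (∑ i, (c i).sum) = n} := by
    unfold coloredPartition
    congr 1
    ext c
    simp only [Set.mem_ofPred_eq, ← Nat.not_even_iff_odd, even_iff_two_dvd]
    constructor
    · rintro ⟨h1, h2, h3⟩
      exact ⟨fun i x hx => ⟨h1 i x hx, fun hi => h2 i hi x hx⟩, h3⟩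
    · rintro ⟨h1, h3⟩
      exact ⟨fun i x hx => (h1 i x hx).1, fun i hi x hx => (h1 i x hx).2 hi, h3⟩
  rw [hs, h]
  have hp : G (fun _ => True) * G (¬ 2 ∣ ·) ^ 10 =
      ∏ i : Fin 11, G (fun x => i.val ≠ 0 → ¬ 2 ∣ x) := by
    rw [Fin.prod_univ_succ]
    simp
  rw [hp, coeff_prod]
  push_cast
  refine sum_congr rfl fun l _ => prod_congr rfl fun i _ => ?_
  simp only [G, coeff_mk]

noncomputable abbrev F : A := pentagonalSeries (ZMod 7)

section top
open WithPiTopology Filter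

lemma GF_one : G (fun _ => True) * F = 1 := by
  classical
  let _ : TopologicalSpace (ZMod 7) := ⊥
  have _ : DiscreteTopology (ZMod 7) := ⟨rfl⟩
  have h1 := (Nat.Partition.hasProd_powerSeriesMk_card_restricted (ZMod 7) (fun _ => True)).mul
    (hasProd_one_sub_X_pow (ZMod 7))
  simp only [if_true, pow_mul] at h1
  have h2 : ∀ i : ℕ, (∑' j : ℕ, ((X : A) ^ (i + 1)) ^ j) * (1 - X ^ (i + 1)) = 1 := fun i =>
    tsum_pow_mul_one_sub_of_constantCoeff_eq_zero (by simp)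
  simp only [h2] at h1
  have := h1.unique hasProd_one
  rw [← this, G]
  congr!

lemma coeff_of_hasProd [TopologicalSpace (ZMod 7)] [DiscreteTopology (ZMod 7)]
    {f : ℕ → A} {g : A} (h : HasProd f g) (n : ℕ) :
    ∀ᶠ N in atTop, coeff n (∏ i ∈ range N, f i) = coeff n g := by
  have := h.tendsto_prod_nat
  rw [tendsto_iff_coeff_tendsto] at this
  simpa using this n

lemma F_congr (n : ℕ) : (X : A) ^ (n + 1) ∣ F - p n := by
  let _ : TopologicalSpace (ZMod 7) := ⊥
  have _ : DiscreteTopology (ZMod 7) := ⟨rfl⟩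
  rw [X_pow_dvd_iff]
  intro m hm
  obtain ⟨N, h1, h2⟩ := ((coeff_of_hasProd (hasProd_one_sub_X_pow (ZMod 7)) m).and
    (eventually_ge_atTop n)).exists
  rw [map_sub, ← h1, ← map_sub]
  exact X_pow_dvd_iff.mp (p_congr n N h2) m hm

lemma GF_two : G (¬ 2 ∣ ·) * F = expand 2 two_ne_zero F := by
  classical
  let _ : TopologicalSpace (ZMod 7) := ⊥
  have _ : DiscreteTopology (ZMod 7) := ⟨rfl⟩
  have e : G (¬ 2 ∣ ·) = PowerSeries.mk fun n ↦ (#(Nat.Partition.countRestricted n 2) : ZMod 7) := by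
    rw [← Nat.Partition.powerSeriesMk_card_restricted_eq_powerSeriesMk_card_countRestricted
      (ZMod 7) two_pos, G]
    congr!
  have h1 := (Nat.Partition.hasProd_powerSeriesMk_card_countRestricted (ZMod 7) two_pos).mul
    (hasProd_one_sub_X_pow (ZMod 7))
  rw [← e] at h1
  have h2 : ∀ i : ℕ, (∑ j ∈ range 2, (X : A) ^ ((i + 1) * j)) * (1 - X ^ (i + 1)) =
      expand 2 two_ne_zero (1 - X ^ (i + 1)) := by
    intro i
    simp [sum_range_succ, ← pow_mul]
    ring
  simp only [h2] at h1
  ext n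
  have h3 := coeff_of_hasProd h1 n
  have h4 := coeff_of_hasProd (hasProd_one_sub_X_pow (ZMod 7)) (n / 2)
  obtain ⟨N, h3, h4⟩ := (h3.and h4).exists
  rw [← h3, ← map_prod, coeff_expand, coeff_expand, h4]

end top

lemma coeff_F3 (d : ℕ) (h : d % 7 ≠ 0 ∧ d % 7 ≠ 1 ∧ d % 7 ≠ 3) : coeff d (F ^ 3) = 0 := by
  have h1 : (X : A) ^ (d + 1) ∣ F ^ 3 - p d ^ 3 := (F_congr d).trans (sub_dvd_pow_sub_pow _ _ 3)
  have h2 := X_pow_dvd_iff.mp h1 d (by omega)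
  rw [map_sub, coeff_p3 d d le_rfl h, sub_zero] at h2
  exact h2

lemma coeff_pow7 (K : A) (d : ℕ) (h : d % 7 ≠ 0) : coeff d (K ^ 7) = 0 := by
  rcases d with _ | d
  · simp at h
  have h1 : d⁄dX (ZMod 7) (K ^ 7) = 0 := by
    rw [derivative_pow]
    have : ((7 : ℕ) : A) = 0 := by
      rw [← map_natCast (C (R := ZMod 7)), ZMod.natCast_self, map_zero]
    rw [this, zero_mul, zero_mul]
  have h2 := coeff_derivative (K ^ 7) d
  rw [h1, map_zero] at h2
  rcases mul_eq_zero.mp h2.symm with h3 | h3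
  · exact h3
  · exfalso
    have h4 : ((d + 1 : ℕ) : ZMod 7) = 0 := by exact_mod_cast h3
    rw [ZMod.natCast_eq_zero_iff] at h4
    omega

lemma coeff_main (n : ℕ) : coeff (7 * n + 4) (G (fun _ => True) * G (¬ 2 ∣ ·) ^ 10) = 0 := by
  have h1 := GF_one
  have h2 := GF_two
  set P := G (fun _ => True)
  set O := G (¬ 2 ∣ ·)
  have e : P * O ^ 10 = (F ^ 3 * expand 2 two_ne_zero (F ^ 3)) *
      (expand 2 two_ne_zero F * P ^ 2) ^ 7 := by
    rw [map_pow, ← h2]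
    calc P * O ^ 10 = P * O ^ 10 * (P * F) ^ 13 := by rw [h1]; ring
      _ = _ := by ring
  rw [e, coeff_mul]
  refine sum_eq_zero fun ab hab => ?_
  rw [HasAntidiagonal.mem_antidiagonal] at hab
  by_cases hb : ab.2 % 7 = 0
  · have : coeff ab.1 (F ^ 3 * expand 2 two_ne_zero (F ^ 3)) = 0 := by
      rw [coeff_mul]
      refine sum_eq_zero fun cd hcd => ?_
      rw [HasAntidiagonal.mem_antidiagonal] at hcd
      rw [coeff_expand]
      split_ifs with h
      · by_cases hc : cd.1 % 7 ≠ 0 ∧ cd.1 % 7 ≠ 1 ∧ cd.1 % 7 ≠ 3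
        · rw [coeff_F3 _ hc, zero_mul]
        · rw [coeff_F3 (cd.2 / 2) (by omega), mul_zero]
      · simp
    rw [this, zero_mul]
  · rw [coeff_pow7 _ _ hb, mul_zero]

end Jac

/-- Ramanujan-type congruence: `a_{11}(7n + 4) ≡ 0 (mod 7)` for all `n ≥ 0`. -/
theorem coloredPartition_eleven_mod_seven (n : ℕ) :
    7 ∣ coloredPartition 11 (7 * n + 4) := by
  rw [← ZMod.natCast_eq_zero_iff, Jac.cast_colored, Jac.coeff_main]
end
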